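/- arXiv:0805.0693 — 2 statements merged into one kernel-verified Lean document; each statement's English description precedes it below -/
import Mathlib

section
/- Let 0<ℓ≤∞, let p ∈ P₁([0,ℓ]) and α, ν ∈ P([0,ℓ]) with 0 ≤ ν(0) < 1/p(0) (and, if ℓ=∞, also 0 ≤ ν(∞) < 1/p(∞)), and let q ∈ P₁([0,ℓ]) satisfy 1/q(0) = 1/p(0) − ν(0) (and, if ℓ=∞, 1/q(∞) = 1/p(∞) − ν(∞)). Then there exists a constant C > 0 such that the Hardy-type inequality ‖ t^{α(t)+ν(t)−1} ∫₀ᵗ f(s) s^{−α(s)} ds ‖_{L^{q(·)}([0,ℓ])} ≤ C ‖f‖_{L^{p(·)}([0,ℓ])} holds for all nonnegative f ∈ L^{p(·)}([0,ℓ]) if and only if α(0) < 1/p′(0) (and, if ℓ=∞, α(∞) < 1/p′(∞)), where 1/p′(t) = 1 − 1/p(t). -/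
open MeasureTheory Filter Set Metric
open scoped ENNReal NNReal Topology

noncomputable section

/-- The non-increasing rearrangement `f*` of `f` with respect to the measure `μ`:
`f*(t) = sup { s ≥ 0 : μ{|f| > s} > t }`. -/
def rearrange {α : Type*} [MeasurableSpace α] (μ : Measure α) (f : α → ℝ) (t : ℝ) : ℝ :=
  sSup {s : ℝ | 0 ≤ s ∧ ENNReal.ofReal t < μ {x | s < |f x|}}

/-- The maximal function of the rearrangement: `f**(t) = (1/t) ∫₀ᵗ f*(s) ds`. -/
def doubleStar {α : Type*} [MeasurableSpace α] (μ : Measure α) (f : α → ℝ) (t : ℝ) : ℝ :=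
  (1 / t) * ∫ s in Ioo (0 : ℝ) t, rearrange μ f s

/-- The Luxemburg norm of `g` in the variable exponent Lebesgue space `L^{q(·)}([0,ℓ])`. -/
def luxNorm (ℓ : ℝ≥0∞) (q : ℝ → ℝ) (g : ℝ → ℝ) : ℝ≥0∞ :=
  sInf {lam : ℝ≥0∞ | 0 < lam ∧
    (∫⁻ t in {t : ℝ | 0 < t ∧ ENNReal.ofReal t < ℓ},
      (ENNReal.ofReal |g t| / lam) ^ q t) ≤ 1}

/-- The class `P([0,ℓ])`: bounded measurable exponents with limits `p0` at `0` and
(if `ℓ = ∞`) `pinf` at `∞`, satisfying log-decay conditions at `0` and at `∞`. -/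
structure ClassP (ℓ : ℝ≥0∞) (p : ℝ → ℝ) (p0 pinf : ℝ) : Prop where
  measurable : Measurable p
  bounded : ∃ M : ℝ, ∀ t : ℝ, 0 ≤ t → ENNReal.ofReal t ≤ ℓ → |p t| ≤ M
  lim_zero : Tendsto p (nhdsWithin 0 (Ioi 0)) (nhds p0)
  decay_zero : ∃ C > 0, ∀ t : ℝ, 0 < t → t ≤ 1 / 2 → |p t - p0| ≤ C / Real.log (1 / t)
  lim_infty : ℓ = ∞ → Tendsto p atTop (nhds pinf)
  decay_infty : ℓ = ∞ → ∃ C > 0, ∀ t : ℝ, 0 ≤ t → |p t - pinf| ≤ C / Real.log (Real.exp 1 + t)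

/-- The class `P_a([0,ℓ]) = P([0,ℓ]) ∩ {p : a < p₋ ≤ p₊ < ∞}`. -/
def ClassPa (a : ℝ) (ℓ : ℝ≥0∞) (p : ℝ → ℝ) (p0 pinf : ℝ) : Prop :=
  ClassP ℓ p p0 pinf ∧
    ∃ pm pM : ℝ, a < pm ∧ ∀ t : ℝ, 0 ≤ t → ENNReal.ofReal t ≤ ℓ → pm ≤ p t ∧ p t ≤ pM

/-- The variable exponent Lorentz norm `‖f‖_{L^{p(·),q(·)}(Ω)}`. -/
def lorentzNorm {α : Type*} [MeasurableSpace α] (μ : Measure α) (p q : ℝ → ℝ)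
    (f : α → ℝ) : ℝ≥0∞ :=
  luxNorm (μ univ) q fun t => t ^ (1 / p t - 1 / q t) * rearrange μ f t

/-- The variable exponent Lorentz norm `‖f‖¹_{L^{p(·),q(·)}(Ω)}` defined via `f**`. -/
def lorentzNorm1 {α : Type*} [MeasurableSpace α] (μ : Measure α) (p q : ℝ → ℝ)
    (f : α → ℝ) : ℝ≥0∞ :=
  luxNorm (μ univ) q fun t => t ^ (1 / p t - 1 / q t) * doubleStar μ f t

/-- The weighted variable exponent Lorentz norm `‖f‖_{L^{p(·),q(·)}_w(Ω)}`. -/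
def wLorentzNorm {α : Type*} [MeasurableSpace α] (μ : Measure α) (w p q : ℝ → ℝ)
    (f : α → ℝ) : ℝ≥0∞ :=
  luxNorm (μ univ) q fun t => w t * t ^ (1 / p t - 1 / q t) * rearrange μ f t

/-- The weighted variable exponent Lorentz norm `‖f‖¹_{L^{p(·),q(·)}_w(Ω)}` via `f**`. -/
def wLorentzNorm1 {α : Type*} [MeasurableSpace α] (μ : Measure α) (w p q : ℝ → ℝ)
    (f : α → ℝ) : ℝ≥0∞ :=
  luxNorm (μ univ) q fun t => w t * t ^ (1 / p t - 1 / q t) * doubleStar μ f t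

/-- An ergodic flow `(T_τ)_{τ∈ℝ}` of measure preserving transformations on `(X,μ)`. -/
structure ErgodicFlow (X : Type*) [MeasurableSpace X] (μ : Measure X)
    (T : ℝ → X → X) : Prop where
  measurable : Measurable fun p : ℝ × X => T p.1 p.2
  preserving : ∀ τ : ℝ, MeasurePreserving (T τ) μ μ
  map_zero : ∀ x, T 0 x = x
  map_add : ∀ s t x, T (s + t) x = T s (T t x)
  ergodic : ∀ A : Set X, MeasurableSet A → (∀ τ, T τ ⁻¹' A = A) → μ A = 0 ∨ μ Aᶜ = 0

/-- The ergodic maximal function `Mf(x) = sup_{a>0} (1/a)∫₀^a |f(T_τ x)| dτ`. -/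
def ergMax {X : Type*} (T : ℝ → X → X) (f : X → ℝ) (x : X) : ℝ :=
  ⨆ a : {a : ℝ // 0 < a}, (1 / (a : ℝ)) * ∫ τ in Ioo (0 : ℝ) (a : ℝ), |f (T τ x)|

/-- The ergodic Hilbert transform
`Hf(x) = lim_{δ→0+} ∫_{δ ≤ |τ| ≤ 1/δ} f(T_τ x)/τ dτ`. -/
def ergHilbert {X : Type*} (T : ℝ → X → X) (f : X → ℝ) (x : X) : ℝ :=
  limUnder (nhdsWithin (0 : ℝ) (Ioi 0)) fun δ =>
    ∫ τ in {τ : ℝ | δ ≤ |τ| ∧ |τ| ≤ 1 / δ}, f (T τ x) / τ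



/-- Logarithmic measure `ds / s` on `(0, ∞)`. -/
def muH : Measure ℝ := (volume.restrict (Ioi (0:ℝ))).withDensity (fun s => ENNReal.ofReal s⁻¹)

instance : SFinite muH := by unfold muH; infer_instance

lemma lintegral_muH {u : ℝ → ℝ≥0∞} (hu : Measurable u) :
    ∫⁻ s, u s ∂muH = ∫⁻ s in Ioi (0:ℝ), u s * ENNReal.ofReal s⁻¹ := by
  unfold muH
  rw [lintegral_withDensity_eq_lintegral_mul _ (by fun_prop) hu]
  simp [mul_comm]

lemma muH_mono {u w : ℝ → ℝ≥0∞} (h : ∀ s, 0 < s → u s ≤ w s) :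
    ∫⁻ s, u s ∂muH ≤ ∫⁻ s, w s ∂muH := by
  apply lintegral_mono_ae
  have : ∀ᵐ s ∂(volume.restrict (Ioi (0:ℝ))), 0 < s := ae_restrict_mem measurableSet_Ioi
  have h2 : muH ≪ volume.restrict (Ioi (0:ℝ)) := withDensity_absolutelyContinuous _ _
  filter_upwards [h2.ae_le this] with s hs using h s hs

/-- Hardy kernel. -/
def kerH (β s t : ℝ) : ℝ≥0∞ := if 0 < s ∧ s < t then ENNReal.ofReal ((s / t) ^ β) else 0

lemma measurable_kerH (β : ℝ) : Measurable (fun x : ℝ × ℝ => kerH β x.1 x.2) := by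
  unfold kerH
  refine Measurable.ite ?_ (by fun_prop) (by fun_prop)
  exact (measurableSet_lt measurable_const measurable_fst).inter
    (measurableSet_lt measurable_fst measurable_snd)

lemma measurable_kerH_left (β t : ℝ) : Measurable (fun s => kerH β s t) :=
  (measurable_kerH β).comp (measurable_id.prodMk measurable_const)

lemma measurable_kerH_right (β s : ℝ) : Measurable (fun t => kerH β s t) :=
  (measurable_kerH β).comp (measurable_const.prodMk measurable_id)

lemma kerH_le_one {β : ℝ} (hβ : 0 < β) (s t : ℝ) : kerH β s t ≤ 1 := by
  unfold kerH
  split_ifs with h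
  · have ht : 0 < t := h.1.trans h.2
    rw [← ENNReal.ofReal_one]
    apply ENNReal.ofReal_le_ofReal
    apply Real.rpow_le_one (by have := h.1; positivity) _ hβ.le
    rw [div_le_one ht]; exact h.2.le
  · simp

lemma kerH_int_left {β : ℝ} (hβ : 0 < β) (t : ℝ) (ht : 0 < t) :
    ∫⁻ s, kerH β s t ∂muH ≤ ENNReal.ofReal (1 / β) := by
  rw [lintegral_muH (measurable_kerH_left β t)]
  have h1 : ∫⁻ s in Ioi (0:ℝ), kerH β s t * ENNReal.ofReal s⁻¹ =
      ∫⁻ s in Ioi (0:ℝ), (Ioo 0 t).indicator (fun s => ENNReal.ofReal (t ^ (-β) * s ^ (β - 1))) s := by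
    apply setLIntegral_congr_fun measurableSet_Ioi
    intro s hs
    have hs : 0 < s := hs
    simp only [kerH, indicator, mem_Ioo]
    split_ifs with h
    · rw [← ENNReal.ofReal_mul (by positivity)]
      congr 1
      rw [Real.div_rpow hs.le ht.le, Real.rpow_neg ht.le, Real.rpow_sub_one hs.ne']
      field_simp
    · simp
  rw [h1, setLIntegral_indicator measurableSet_Ioo]
  have h2 : Ioo 0 t ∩ Ioi 0 = Ioo 0 t := by ext x; simp; tauto
  rw [h2]
  have hintg : IntegrableOn (fun s : ℝ => t ^ (-β) * s ^ (β - 1)) (Ioo 0 t) := by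
    apply Integrable.const_mul
    have := (intervalIntegral.intervalIntegrable_rpow' (a := 0) (b := t) (r := β - 1) (by linarith))
    rw [intervalIntegrable_iff_integrableOn_Ioo_of_le ht.le] at this
    exact this
  rw [← ofReal_integral_eq_lintegral_ofReal hintg]
  · apply ENNReal.ofReal_le_ofReal
    rw [← integral_Ioc_eq_integral_Ioo, ← intervalIntegral.integral_of_le ht.le,
      intervalIntegral.integral_const_mul, integral_rpow (Or.inl (by linarith))]
    have : (0:ℝ) ^ (β - 1 + 1) = 0 := Real.zero_rpow (by linarith)
    rw [this, Real.rpow_neg ht.le]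
    have : t ^ β ≠ 0 := by positivity
    simp
    field_simp
    exact le_refl _
  · filter_upwards [ae_restrict_mem measurableSet_Ioo] with s hs
    have := hs.1
    positivity

lemma kerH_int_right {β : ℝ} (hβ : 0 < β) (s : ℝ) (hs : 0 < s) :
    ∫⁻ t, kerH β s t ∂muH ≤ ENNReal.ofReal (1 / β) := by
  rw [lintegral_muH (measurable_kerH_right β s)]
  have h1 : ∫⁻ t in Ioi (0:ℝ), kerH β s t * ENNReal.ofReal t⁻¹ =
      ∫⁻ t in Ioi (0:ℝ), (Ioi s).indicator (fun t => ENNReal.ofReal (s ^ β * t ^ (-β - 1))) t := by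
    apply setLIntegral_congr_fun measurableSet_Ioi
    intro t ht
    have ht : 0 < t := ht
    simp only [kerH, indicator, mem_Ioi, hs, true_and]
    split_ifs with h
    · rw [← ENNReal.ofReal_mul (by positivity)]
      congr 1
      rw [Real.div_rpow hs.le ht.le, Real.rpow_sub_one ht.ne', Real.rpow_neg ht.le]
      field_simp
    · simp
  rw [h1, setLIntegral_indicator measurableSet_Ioi]
  have h2 : Ioi s ∩ Ioi 0 = Ioi s := by ext x; simp; intro h; linarith
  rw [h2]
  have hintg : IntegrableOn (fun t : ℝ => s ^ β * t ^ (-β - 1)) (Ioi s) := by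
    apply Integrable.const_mul
    exact integrableOn_Ioi_rpow_of_lt (by linarith) hs
  rw [← ofReal_integral_eq_lintegral_ofReal hintg]
  · apply ENNReal.ofReal_le_ofReal
    rw [integral_const_mul, integral_Ioi_rpow_of_lt (by linarith) hs]
    have : s ^ β ≠ 0 := by positivity
    simp [Real.rpow_neg hs.le]
    field_simp
    exact le_refl _
  · filter_upwards [ae_restrict_mem measurableSet_Ioi] with t ht
    have : 0 < t := hs.trans ht
    positivity

/-- `min(t, 1/t)`. -/
def thH (t : ℝ) : ℝ := min t t⁻¹

lemma thH_pos {t : ℝ} (ht : 0 < t) : 0 < thH t := lt_min ht (by positivity)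

lemma thH_le_one (t : ℝ) : thH t ≤ 1 := by
  unfold thH
  rcases le_total t 1 with h | h
  · exact (min_le_left _ _).trans h
  · exact (min_le_right _ _).trans (inv_le_one_of_one_le₀ h)

lemma thH_of_le {t : ℝ} (ht : 0 < t) (h : t ≤ 1) : thH t = t :=
  min_eq_left (h.trans ((one_le_inv₀ ht).2 h))

lemma thH_of_ge {t : ℝ} (h : 1 ≤ t) : thH t = t⁻¹ :=
  min_eq_right ((inv_le_one_of_one_le₀ h).trans h)

lemma abs_log_thH {t : ℝ} (ht : 0 < t) : |Real.log (thH t)| = |Real.log t| := by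
  rcases le_total t 1 with h | h
  · rw [thH_of_le ht h]
  · rw [thH_of_ge h, Real.log_inv, abs_neg]

lemma measurable_thH : Measurable thH := by unfold thH; fun_prop

/-- `min(t,1/t)^β` in `ENNReal`. -/
def ThH (β t : ℝ) : ℝ≥0∞ := ENNReal.ofReal (thH t ^ β)

lemma measurable_ThH (β : ℝ) : Measurable (ThH β) := by
  unfold ThH
  exact (measurable_thH.pow_const β).ennreal_ofReal

lemma ThH_int {β : ℝ} (hβ : 0 < β) : ∫⁻ t, ThH β t ∂muH < ∞ := by
  have h1 := kerH_int_left hβ 1 one_pos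
  have h2 := kerH_int_right hβ 1 one_pos
  have h3 : ∫⁻ t, ThH β t ∂muH ≤ ∫⁻ t, (kerH β t 1 + kerH β 1 t) + ({1} : Set ℝ).indicator 1 t ∂muH := by
    apply muH_mono
    intro t ht
    rcases lt_trichotomy t 1 with h | h | h
    · refine le_trans ?_ (le_add_right (le_add_right le_rfl))
      simp [ThH, kerH, ht, h, thH_of_le ht h.le]
    · subst h
      simp [ThH, thH]
    · refine le_trans ?_ (le_add_right (le_add_left le_rfl))
      simp [ThH, kerH, h, thH_of_ge h.le]
  refine h3.trans_lt ?_
  rw [lintegral_add_right _ (measurable_one.indicator (measurableSet_singleton 1)),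
    lintegral_add_right _ (measurable_kerH_right β 1)]
  have h4 : ∫⁻ t, ({1} : Set ℝ).indicator 1 t ∂muH = 0 := by
    rw [lintegral_indicator_one (measurableSet_singleton 1)]
    have h2 : muH ≪ volume.restrict (Ioi (0:ℝ)) := withDensity_absolutelyContinuous _ _
    exact h2 (by simp)
  rw [h4, add_zero]
  exact ENNReal.add_lt_top.2 ⟨h1.trans_lt ENNReal.ofReal_lt_top, h2.trans_lt ENNReal.ofReal_lt_top⟩

lemma thH_le_ThH {β t : ℝ} (hβ1 : β ≤ 1) (ht : 0 < t) :
    ENNReal.ofReal (thH t) ≤ ThH β t := by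
  unfold ThH
  apply ENNReal.ofReal_le_ofReal
  exact Real.self_le_rpow_of_le_one (thH_pos ht).le (thH_le_one t) hβ1

/-- Weighted Jensen inequality. -/
lemma jensenH {k u : ℝ → ℝ≥0∞} (hk : Measurable k) (hu : Measurable u) {r : ℝ} (hr : 1 ≤ r) :
    (∫⁻ s, k s * u s ∂muH) ^ r ≤ (∫⁻ s, k s ∂muH) ^ (r - 1) * ∫⁻ s, k s * u s ^ r ∂muH := by
  have hr0 : 0 < r := by linarith
  have hi : r⁻¹ ≤ 1 := inv_le_one_of_one_le₀ hr
  have h := ENNReal.lintegral_mul_norm_pow_le (μ := muH) (f := k) (g := fun s => k s * u s ^ r)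
    hk.aemeasurable (hk.mul (hu.pow_const r)).aemeasurable (p := 1 - r⁻¹) (q := r⁻¹)
    (by linarith) (by positivity) (by ring)
  have e : ∀ s, k s ^ (1 - r⁻¹) * (k s * u s ^ r) ^ r⁻¹ = k s * u s := by
    intro s
    rw [ENNReal.mul_rpow_of_nonneg _ _ (by positivity), ← mul_assoc,
      ← ENNReal.rpow_add_of_nonneg _ _ (by linarith) (by positivity), ← ENNReal.rpow_mul,
      mul_inv_cancel₀ hr0.ne']
    simp
  simp only [e] at h
  have h2 := ENNReal.rpow_le_rpow h hr0.le
  refine h2.trans (le_of_eq ?_)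
  rw [ENNReal.mul_rpow_of_nonneg _ _ hr0.le, ← ENNReal.rpow_mul, ← ENNReal.rpow_mul,
    inv_mul_cancel₀ hr0.ne', ENNReal.rpow_one]
  congr 2
  field_simp

/-- Key comparison. -/
lemma pow_compare {x : ℝ≥0∞} (hx : x ≤ 1) {r r' θ K : ℝ} (hr : 1 ≤ r) 
    (hθ : 0 < θ) (hθ1 : θ ≤ 1) (hK : |r - r'| * |Real.log θ| ≤ K) :
    x ^ r ≤ ENNReal.ofReal (Real.exp K) * x ^ r' + ENNReal.ofReal θ := by
  lift x to ℝ≥0 using ne_top_of_le_ne_top ENNReal.one_ne_top hx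
  have hx' : (x:ℝ) ≤ 1 := by exact_mod_cast hx
  rcases lt_or_ge (x:ℝ) θ with h | h
  · refine le_trans ?_ (le_add_left le_rfl)
    calc (x:ℝ≥0∞) ^ r ≤ x ^ (1:ℝ) := ENNReal.rpow_le_rpow_of_exponent_ge hx hr
      _ = ENNReal.ofReal x := by simp
      _ ≤ _ := ENNReal.ofReal_le_ofReal h.le
  · refine le_trans ?_ (le_add_right le_rfl)
    have hx0 : 0 < (x:ℝ) := hθ.trans_le h
    have hx1 : (x:ℝ≥0∞) = ENNReal.ofReal x := by simp
    rw [hx1, ENNReal.ofReal_rpow_of_pos hx0, ENNReal.ofReal_rpow_of_pos hx0,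
      ← ENNReal.ofReal_mul (Real.exp_pos _).le]
    apply ENNReal.ofReal_le_ofReal
    rw [Real.rpow_def_of_pos hx0, Real.rpow_def_of_pos hx0, ← Real.exp_add]
    apply Real.exp_le_exp.2
    have l1 : Real.log x ≤ 0 := Real.log_nonpos hx0.le hx'
    have l2 : Real.log θ ≤ Real.log x := Real.log_le_log hθ h
    have : (r - r') * Real.log x ≤ |r - r'| * |Real.log θ| := by
      calc _ ≤ |(r - r') * Real.log x| := le_abs_self _
        _ = |r - r'| * |Real.log x| := abs_mul _ _
        _ ≤ _ := by
          apply mul_le_mul_of_nonneg_left _ (abs_nonneg _)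
          rw [abs_of_nonpos l1, abs_of_nonpos (l2.trans l1)]; linarith
    linarith

/-- Step function with values `c` on `(0,1]` and `d` on `(1,∞)`. -/
def stH (c d t : ℝ) : ℝ := if t ≤ 1 then c else d

lemma stH_prop {c d : ℝ} (P : ℝ → Prop) (hc : P c) (hd : P d) (t : ℝ) : P (stH c d t) := by
  unfold stH; split_ifs <;> assumption

lemma core_point {p : ℝ → ℝ} {p0 p1 K β : ℝ} (hβ1 : β ≤ 1)
    (h1p : ∀ t, 1 ≤ p t) (hp0 : 1 ≤ p0) (hp1 : 1 ≤ p1)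
    (hpK : ∀ t, 0 < t → |p t - stH p0 p1 t| * |Real.log t| ≤ K)
    (x : ℝ≥0∞) {s t : ℝ} (hs : 0 < s) :
    kerH β s t * (min x 1) ^ (stH p0 p1 t) ≤
      ENNReal.ofReal (Real.exp K) * (kerH β s t * x ^ (p s)) + kerH β s t * ThH β s
        + ThH β s * ThH β t := by
  by_cases hst : s < t
  swap
  · simp [kerH, hst]
  have h1 : 1 ≤ stH p0 p1 t := stH_prop (fun x => 1 ≤ x) hp0 hp1 t
  by_cases hc : s ≤ 1 ∧ 1 < t
  · refine le_trans ?_ (le_add_left le_rfl)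
    have h2 : kerH β s t = ThH β s * ThH β t := by
      unfold kerH ThH
      rw [if_pos ⟨hs, hst⟩, thH_of_le hs hc.1, thH_of_ge hc.2.le,
        ← ENNReal.ofReal_mul (by positivity), div_eq_mul_inv, Real.mul_rpow hs.le]
      have : 0 < t := hs.trans hst
      positivity
    rw [h2]
    refine mul_le_of_le_one_right (by simp) ?_
    exact ENNReal.rpow_le_one (min_le_right _ _) (by linarith)
  · refine le_trans ?_ (le_add_right le_rfl)
    have h2 : stH p0 p1 t = stH p0 p1 s := by
      unfold stH
      rcases le_or_gt s 1 with h | h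
      · have : t ≤ 1 := by by_contra h'; exact hc ⟨h, not_le.1 h'⟩
        simp [h, this]
      · have : ¬ t ≤ 1 := by linarith
        have : ¬ s ≤ 1 := by linarith
        simp [*]
    have h3 := pow_compare (x := min x 1) (min_le_right _ _) (r := stH p0 p1 t) (r' := p s)
      (θ := thH s) (K := K) h1 (thH_pos hs) (thH_le_one s)
      (by rw [abs_log_thH hs, h2, abs_sub_comm]; exact hpK s hs)
    have h4 : (min x 1) ^ (p s) ≤ x ^ (p s) :=
      ENNReal.rpow_le_rpow (min_le_left _ _) (by linarith [h1p s])
    calc _ ≤ kerH β s t * (ENNReal.ofReal (Real.exp K) * x ^ (p s) + ThH β s) := by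
            gcongr
            refine h3.trans ?_
            gcongr
            exact thH_le_ThH hβ1 hs
      _ = _ := by ring

lemma tonelliH {β : ℝ} (hβ : 0 < β) {u : ℝ → ℝ≥0∞} (hu : Measurable u) :
    ∫⁻ t, ∫⁻ s, kerH β s t * u s ∂muH ∂muH ≤ ENNReal.ofReal (1 / β) * ∫⁻ s, u s ∂muH := by
  rw [lintegral_lintegral_swap]
  · rw [← lintegral_const_mul _ hu]
    apply muH_mono
    intro s hs
    rw [lintegral_mul_const _ (measurable_kerH_right β s)]
    gcongr
    exact kerH_int_right hβ s hs
  · apply Measurable.aemeasurable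
    have : Measurable (fun x : ℝ × ℝ => kerH β x.2 x.1) := (measurable_kerH β).comp measurable_swap
    exact this.mul (hu.comp measurable_snd)

lemma rpow_le_maxH {M : ℝ≥0∞} (hM : 1 ≤ M) {r Q : ℝ} (h : r ≤ Q) : M ^ r ≤ M ^ Q :=
  ENNReal.rpow_le_rpow_of_exponent_le hM h

/-- Hardy inequality in modular form with respect to the measure `ds/s`. -/
lemma coreH {p q : ℝ → ℝ} {p0 p1 q0 q1 K β Q : ℝ} (hβ : 0 < β) (hβ1 : β ≤ 1)
    (hpm : Measurable p)
    (h1p : ∀ t, 1 ≤ p t) (h1q : ∀ t, 1 ≤ q t) (hqQ : ∀ t, q t ≤ Q)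
    (hp0 : 1 ≤ p0) (hp1 : 1 ≤ p1) (hp0Q : p0 ≤ Q) (hp1Q : p1 ≤ Q) (hpq0 : p0 ≤ q0) (hpq1 : p1 ≤ q1)
    (hpK : ∀ t, 0 < t → |p t - stH p0 p1 t| * |Real.log t| ≤ K)
    (hqK : ∀ t, 0 < t → |q t - stH q0 q1 t| * |Real.log t| ≤ K)
    (C1 : ℝ≥0∞) (hC1 : C1 < ∞) :
    ∃ B : ℝ≥0∞, B < ∞ ∧ ∀ h : ℝ → ℝ≥0∞, Measurable h → ∫⁻ s, h s ^ p s ∂muH ≤ C1 →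
      ∫⁻ t, (∫⁻ s, kerH β s t * h s ∂muH) ^ q t ∂muH ≤ B := by
  set b : ℝ≥0∞ := ENNReal.ofReal (1 / β) with hb
  set T := ∫⁻ t, ThH β t ∂muH with hT
  set E := ENNReal.ofReal (Real.exp K) with hE
  have hbt : b < ∞ := ENNReal.ofReal_lt_top
  have hb1 : 1 ≤ b := by
    rw [hb, ← ENNReal.ofReal_one]
    exact ENNReal.ofReal_le_ofReal ((one_le_div hβ).2 hβ1)
  have hTt : T < ∞ := ThH_int hβ
  have hEt : E < ∞ := ENNReal.ofReal_lt_top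
  set M : ℝ≥0∞ := C1 + b with hM
  have hM1 : 1 ≤ M := hb1.trans (by simp [hM])
  have hMt : M < ∞ := ENNReal.add_lt_top.2 ⟨hC1, hbt⟩
  have hQ : 0 ≤ Q := by linarith
  refine ⟨M ^ Q * (E * (2 ^ Q * (b * C1 + b ^ Q * (E * (b * C1) + b * T + T * T))) + T), ?_, ?_⟩
  · have x1 : M ^ Q ≠ ∞ := ENNReal.rpow_ne_top_of_nonneg hQ hMt.ne
    have x2 : b ^ Q ≠ ∞ := ENNReal.rpow_ne_top_of_nonneg hQ hbt.ne
    have x3 : (2:ℝ≥0∞) ^ Q ≠ ∞ := ENNReal.rpow_ne_top_of_nonneg hQ (by simp)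
    have x4 := hbt.ne
    have x5 := hTt.ne
    have x6 := hEt.ne
    have x7 := hC1.ne
    have : M ^ Q * (E * (2 ^ Q * (b * C1 + b ^ Q * (E * (b * C1) + b * T + T * T))) + T) ≠ ∞ := by
      finiteness
    exact this.lt_top
  intro h hh hintg
  have hhp : Measurable (fun s => h s ^ p s) := hh.pow hpm
  set g1 : ℝ → ℝ≥0∞ := fun t => ∫⁻ s, kerH β s t * h s ^ p s ∂muH with hg1
  set g2 : ℝ → ℝ≥0∞ := fun t => ∫⁻ s, kerH β s t * min (h s) 1 ∂muH with hg2
  set g3 : ℝ → ℝ≥0∞ := fun t => ∫⁻ s, kerH β s t * ThH β s ∂muH with hg3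
  have mk2 : Measurable (fun x : ℝ × ℝ => kerH β x.2 x.1) := (measurable_kerH β).comp measurable_swap
  have mg1 : Measurable g1 := 
    Measurable.lintegral_prod_right' (f := fun x : ℝ × ℝ => kerH β x.2 x.1 * h x.2 ^ p x.2)
      (mk2.mul (hhp.comp measurable_snd))
  have mg3 : Measurable g3 := 
    Measurable.lintegral_prod_right' (f := fun x : ℝ × ℝ => kerH β x.2 x.1 * ThH β x.2)
      (mk2.mul ((measurable_ThH β).comp measurable_snd))
  have hmin : Measurable (fun s => min (h s) 1) := hh.min measurable_const
  have hg : ∀ t, ∫⁻ s, kerH β s t * h s ∂muH ≤ g1 t + g2 t := by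
    intro t
    have mkl := measurable_kerH_left β t
    have m1 : Measurable (fun s => kerH β s t * h s ^ p s) := mkl.mul hhp
    simp only [hg1, hg2]
    rw [← lintegral_add_left m1]
    apply lintegral_mono
    intro s
    simp only
    rw [← mul_add]
    gcongr
    rcases le_total (h s) 1 with h' | h'
    · rw [min_eq_left h']; exact le_add_left le_rfl
    · refine le_trans ?_ (le_add_right le_rfl)
      calc h s = h s ^ (1:ℝ) := by simp
        _ ≤ _ := ENNReal.rpow_le_rpow_of_exponent_le h' (h1p s)
  have hg1le : ∀ t, g1 t ≤ C1 := by
    intro t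
    refine le_trans (lintegral_mono fun s => ?_) hintg
    exact mul_le_of_le_one_left (by simp) (kerH_le_one hβ s t)
  have hg2le : ∀ t, 0 < t → g2 t ≤ b := by
    intro t ht
    refine le_trans (lintegral_mono fun s => ?_) (kerH_int_left hβ t ht)
    exact mul_le_of_le_one_right (by simp) (min_le_right _ _)
  have hM0 : M ≠ 0 := (one_pos.trans_le hM1).ne'
  have hg2p : ∀ t, 0 < t → g2 t ^ stH p0 p1 t ≤ b ^ Q * (E * g1 t + g3 t + T * ThH β t) := by
    intro t ht
    have hst : 1 ≤ stH p0 p1 t := stH_prop (fun x => 1 ≤ x) hp0 hp1 t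
    have hstQ : stH p0 p1 t ≤ Q := stH_prop (fun x => x ≤ Q) hp0Q hp1Q t
    refine (jensenH (measurable_kerH_left β t) hmin hst).trans ?_
    gcongr
    · calc _ ≤ b ^ (stH p0 p1 t - 1) := ENNReal.rpow_le_rpow (kerH_int_left hβ t ht) (by linarith)
        _ ≤ _ := rpow_le_maxH hb1 (by linarith)
    · calc _ ≤ ∫⁻ s, E * (kerH β s t * h s ^ (p s)) + kerH β s t * ThH β s
                + ThH β s * ThH β t ∂muH := by
              apply muH_mono
              intro s hs
              exact core_point hβ1 h1p hp0 hp1 hpK (h s) hs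
        _ = _ := by
              have mkl := measurable_kerH_left β t
              have m1 : Measurable (fun s => kerH β s t * h s ^ p s) := mkl.mul hhp
              have m2 : Measurable (fun s => kerH β s t * ThH β s) := mkl.mul (measurable_ThH β)
              rw [lintegral_add_right _ ((measurable_ThH β).mul_const _),
                lintegral_add_right _ m2,
                lintegral_const_mul _ m1,
                lintegral_mul_const _ (measurable_ThH β)]
  have hpt : ∀ t, 0 < t → (∫⁻ s, kerH β s t * h s ∂muH) ^ q t ≤
      M ^ Q * (E * (2 ^ Q * (g1 t + b ^ Q * (E * g1 t + g3 t + T * ThH β t))) + ThH β t) := by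
    intro t ht
    have hst : 1 ≤ stH p0 p1 t := stH_prop (fun x => 1 ≤ x) hp0 hp1 t
    have hstQ : stH p0 p1 t ≤ Q := stH_prop (fun x => x ≤ Q) hp0Q hp1Q t
    have hpq : stH p0 p1 t ≤ stH q0 q1 t := by unfold stH; split_ifs <;> assumption
    have hq0 : 0 ≤ q t := by linarith [h1q t]
    set x := (g1 t + g2 t) / M with hx
    have hx1 : x ≤ 1 := by
      rw [hx]
      apply ENNReal.div_le_of_le_mul
      rw [one_mul]
      exact add_le_add (hg1le t) (hg2le t ht)
    have hxM : g1 t + g2 t = M * x := by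
      rw [hx, ENNReal.mul_div_cancel hM0 hMt.ne]
    have e1 : (g1 t / M) ≤ 1 := by
      apply ENNReal.div_le_of_le_mul
      rw [one_mul]
      exact (hg1le t).trans (by simp [hM])
    calc _ ≤ (M * x) ^ q t := by
            rw [← hxM]
            exact ENNReal.rpow_le_rpow (hg t) hq0
      _ = M ^ q t * x ^ q t := ENNReal.mul_rpow_of_nonneg _ _ hq0
      _ ≤ M ^ Q * (E * x ^ stH q0 q1 t + ENNReal.ofReal (thH t)) := by
            gcongr
            · exact hqQ t
            · exact pow_compare hx1 (h1q t) (thH_pos ht) (thH_le_one t)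
                (by rw [abs_log_thH ht]; exact hqK t ht)
      _ ≤ M ^ Q * (E * x ^ stH p0 p1 t + ThH β t) := by
            gcongr M ^ Q * (E * ?_ + ?_)
            · exact ENNReal.rpow_le_rpow_of_exponent_ge hx1 hpq
            · exact thH_le_ThH hβ1 ht
      _ ≤ _ := by
            gcongr M ^ Q * (E * ?_ + _)
            rw [hx, ENNReal.add_div]
            refine (ENNReal.add_rpow_le_two_rpow_mul_rpow_add_rpow _ _ (by linarith)).trans ?_
            gcongr
            · simp
            · calc _ ≤ (g1 t / M) ^ (1:ℝ) := ENNReal.rpow_le_rpow_of_exponent_ge e1 hst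
                _ = g1 t / M := by simp
                _ ≤ _ := ENNReal.div_le_of_le_mul (le_mul_of_one_le_right (by simp) hM1)
            · refine le_trans ?_ (hg2p t ht)
              apply ENNReal.rpow_le_rpow _ (by linarith)
              exact ENNReal.div_le_of_le_mul (le_mul_of_one_le_right (by simp) hM1)
  refine (muH_mono hpt).trans ?_
  have i1 : ∫⁻ t, g1 t ∂muH ≤ b * C1 := (tonelliH hβ hhp).trans (by gcongr)
  have i3 : ∫⁻ t, g3 t ∂muH ≤ b * T := tonelliH hβ (measurable_ThH β)
  have mT := measurable_ThH β
  rw [lintegral_const_mul _ (by fun_prop), lintegral_add_left (by fun_prop),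
    lintegral_const_mul _ (by fun_prop), lintegral_const_mul _ (by fun_prop),
    lintegral_add_left (by fun_prop), lintegral_const_mul _ (by fun_prop),
    lintegral_add_left (by fun_prop), lintegral_add_left (by fun_prop),
    lintegral_const_mul _ (by fun_prop), lintegral_const_mul _ (by fun_prop)]
  gcongr

lemma log_bound {x y c L K : ℝ} (h : |x - y| * |L| ≤ K) (hc : |c| ≤ 1) : c * ((x - y) * L) ≤ K := by
  calc _ ≤ |c * ((x - y) * L)| := le_abs_self _
    _ = |c| * (|x - y| * |L|) := by rw [abs_mul, abs_mul]
    _ ≤ 1 * (|x - y| * |L|) := by gcongr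
    _ ≤ K := by linarith

lemma kernel_point {p0 p1 q0 q1 a0 a1 v0 v1 K β s t as at' vt : ℝ}
    (hs : 0 < s) (hst : s < t)
    (hβ0 : β ≤ 1 - 1 / p0 - a0) (hβ1 : β ≤ 1 - 1 / p1 - a1)
    (hq0 : 1 / q0 = 1 / p0 - v0) (hq1 : 1 / q1 = 1 / p1 - v1)
    (has : |as - stH a0 a1 s| * |Real.log s| ≤ K)
    (hat : |at' - stH a0 a1 t| * |Real.log t| ≤ K)
    (hvt : |vt - stH v0 v1 t| * |Real.log t| ≤ K) :
    t ^ (at' + vt - 1) * s ^ (-as) ≤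
      (Real.exp (3 * K) * t ^ (- (1 / stH q0 q1 t))) * ((s / t) ^ β * s ^ (1 / stH p0 p1 s) * s⁻¹) := by
  have ht : 0 < t := hs.trans hst
  have hsi : s⁻¹ = Real.exp (- Real.log s) := by rw [Real.exp_neg, Real.exp_log hs]
  rw [hsi]
  simp only [Real.rpow_def_of_pos ht, Real.rpow_def_of_pos hs, Real.rpow_def_of_pos (div_pos hs ht),
    Real.log_div hs.ne' ht.ne', ← Real.exp_add]
  apply Real.exp_le_exp.2
  have b1 := log_bound (c := -1) has (by simp)
  have b2 := log_bound (c := 1) hat (by simp)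
  have b3 := log_bound (c := 1) hvt (by simp)
  have hl : Real.log s ≤ Real.log t := Real.log_le_log hs hst.le
  have hqt : 1 / stH q0 q1 t = 1 / stH p0 p1 t - stH v0 v1 t := by
    unfold stH; split_ifs <;> assumption
  rw [hqt]
  have key : (1 - 1 / stH p0 p1 s - stH a0 a1 s - β) * Real.log s ≤
      (1 - 1 / stH p0 p1 t - stH a0 a1 t - β) * Real.log t := by
    unfold stH
    rcases le_or_gt s 1 with h1 | h1
    · rcases le_or_gt t 1 with h2 | h2
      · simp only [h1, h2, if_true]
        exact mul_le_mul_of_nonneg_left hl (by linarith)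
      · simp only [h1, not_le.2 h2, if_true, if_false]
        have := Real.log_nonpos hs.le h1
        have := Real.log_nonneg h2.le
        have := mul_nonneg (show 0 ≤ 1 - 1 / p1 - a1 - β by linarith) this
        have := mul_nonpos_of_nonneg_of_nonpos (show 0 ≤ 1 - 1 / p0 - a0 - β by linarith)
          (Real.log_nonpos hs.le h1)
        linarith
    · simp only [not_le.2 h1, not_le.2 (h1.trans hst), if_false]
      exact mul_le_mul_of_nonneg_left hl (by linarith)
  nlinarith [key, b1, b2, b3]

lemma mainH {p q a v : ℝ → ℝ} {p0 p1 q0 q1 a0 a1 v0 v1 K Q : ℝ} 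
    (hpm : Measurable p) (hqm : Measurable q)
    (h1p : ∀ t, 1 ≤ p t) (h1q : ∀ t, 1 ≤ q t) (hqQ : ∀ t, q t ≤ Q)
    (hp0 : 1 ≤ p0) (hp1 : 1 ≤ p1) (hp0Q : p0 ≤ Q) (hp1Q : p1 ≤ Q) (hpq0 : p0 ≤ q0) (hpq1 : p1 ≤ q1)
    (hpK : ∀ t, 0 < t → |p t - stH p0 p1 t| * |Real.log t| ≤ K)
    (hqK : ∀ t, 0 < t → |q t - stH q0 q1 t| * |Real.log t| ≤ K)
    (haK : ∀ t, 0 < t → |a t - stH a0 a1 t| * |Real.log t| ≤ K)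
    (hvK : ∀ t, 0 < t → |v t - stH v0 v1 t| * |Real.log t| ≤ K)
    (ha0 : a0 < 1 - 1 / p0) (ha1 : a1 < 1 - 1 / p1)
    (hq0 : 1 / q0 = 1 / p0 - v0) (hq1 : 1 / q1 = 1 / p1 - v1) :
    ∃ B : ℝ≥0∞, B < ∞ ∧ ∀ F : ℝ → ℝ≥0∞, Measurable F → ∫⁻ s in Ioi (0:ℝ), F s ^ p s ≤ 1 →
      ∫⁻ t in Ioi (0:ℝ), (ENNReal.ofReal (t ^ (a t + v t - 1)) *
        ∫⁻ s in Ioo 0 t, F s * ENNReal.ofReal (s ^ (-(a s)))) ^ q t ≤ B := by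
  have hK0 : 0 ≤ K := le_trans (by positivity) (hpK 1 one_pos)
  obtain ⟨β, hβ, hβ1, hb0, hb1⟩ : ∃ β : ℝ, 0 < β ∧ β ≤ 1 ∧ β ≤ 1 - 1 / p0 - a0 ∧
      β ≤ 1 - 1 / p1 - a1 := by
    refine ⟨min 1 (min (1 - 1 / p0 - a0) (1 - 1 / p1 - a1)), ?_, ?_, ?_, ?_⟩
    · refine lt_min one_pos (lt_min ?_ ?_) <;> linarith
    · exact min_le_left _ _
    · exact (min_le_right _ _).trans (min_le_left _ _)
    · exact (min_le_right _ _).trans (min_le_right _ _)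
  obtain ⟨B, hB, hcore⟩ := coreH hβ hβ1 hpm h1p h1q hqQ hp0 hp1 hp0Q hp1Q hpq0 hpq1 hpK hqK
    (ENNReal.ofReal (Real.exp K)) ENNReal.ofReal_lt_top
  refine ⟨ENNReal.ofReal (Real.exp (3 * K * Q + K)) * B, ENNReal.mul_lt_top ENNReal.ofReal_lt_top hB, ?_⟩
  intro F hF hintg
  have mst : Measurable (stH p0 p1) := by
    unfold stH
    exact Measurable.ite measurableSet_Iic measurable_const measurable_const
  set h : ℝ → ℝ≥0∞ := fun s => F s * ENNReal.ofReal (s ^ (1 / stH p0 p1 s)) with hh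
  have hm : Measurable h := by
    apply hF.mul
    apply Measurable.ennreal_ofReal
    exact measurable_id.pow (measurable_const.div mst)
  have hC : ∫⁻ s, h s ^ p s ∂muH ≤ ENNReal.ofReal (Real.exp K) := by
    rw [lintegral_muH (hm.pow hpm)]
    calc _ ≤ ∫⁻ s in Ioi (0:ℝ), ENNReal.ofReal (Real.exp K) * F s ^ p s := by
          apply setLIntegral_mono' measurableSet_Ioi
          intro s hs
          have hs : 0 < s := hs
          have hst : 1 ≤ stH p0 p1 s := stH_prop (fun x => 1 ≤ x) hp0 hp1 s
          simp only [hh]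
          rw [ENNReal.mul_rpow_of_nonneg _ _ (by linarith [h1p s]),
            ENNReal.ofReal_rpow_of_pos (by positivity), mul_assoc, mul_comm (ENNReal.ofReal (Real.exp K)),
            ← ENNReal.ofReal_mul (by positivity)]
          gcongr
          have hsi : s⁻¹ = Real.exp (- Real.log s) := by rw [Real.exp_neg, Real.exp_log hs]
          rw [hsi, ← Real.rpow_mul hs.le, Real.rpow_def_of_pos hs, ← Real.exp_add]
          apply Real.exp_le_exp.2
          have := log_bound (c := 1 / stH p0 p1 s) (hpK s hs) (by
            rw [abs_of_nonneg (by positivity), div_le_one (by linarith)]; exact hst)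
          refine le_trans (le_of_eq ?_) this
          field_simp
          ring
      _ ≤ _ := by
          rw [lintegral_const_mul _ (hF.pow hpm)]
          exact mul_le_of_le_one_right (by simp) hintg
  have hfin := hcore h hm hC
  set g : ℝ → ℝ≥0∞ := fun t => ∫⁻ s, kerH β s t * h s ∂muH with hg
  have mk2 : Measurable (fun x : ℝ × ℝ => kerH β x.2 x.1) := (measurable_kerH β).comp measurable_swap
  have mg : Measurable g := 
    Measurable.lintegral_prod_right' (f := fun x : ℝ × ℝ => kerH β x.2 x.1 * h x.2)
      (mk2.mul (hm.comp measurable_snd))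
  have hG : ∀ t, 0 < t → ENNReal.ofReal (t ^ (a t + v t - 1)) *
        ∫⁻ s in Ioo 0 t, F s * ENNReal.ofReal (s ^ (-(a s))) ≤
        ENNReal.ofReal (Real.exp (3 * K) * t ^ (- (1 / stH q0 q1 t))) * g t := by
    intro t ht
    have mkh : Measurable (fun s => kerH β s t * h s) := (measurable_kerH_left β t).mul hm
    simp only [hg]
    rw [lintegral_muH mkh, ← lintegral_const_mul' _ _ ENNReal.ofReal_ne_top,
      ← lintegral_const_mul' _ _ ENNReal.ofReal_ne_top]
    refine le_trans ?_ (lintegral_mono_set (s := Ioo 0 t) (fun x hx => hx.1))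
    apply setLIntegral_mono' measurableSet_Ioo
    intro s hs
    have hs0 := hs.1
    have hk : kerH β s t = ENNReal.ofReal ((s / t) ^ β) := by
      unfold kerH; rw [if_pos]; exact hs
    have hpt := kernel_point hs.1 hs.2 hb0 hb1 hq0 hq1 (haK s hs.1) (haK t ht) (hvK t ht)
    have hpt2 := ENNReal.ofReal_le_ofReal hpt
    rw [ENNReal.ofReal_mul (by positivity), ENNReal.ofReal_mul (by positivity),
      ENNReal.ofReal_mul (p := (s / t) ^ β * s ^ (1 / stH p0 p1 s)) (by positivity),
      ENNReal.ofReal_mul (p := (s / t) ^ β) (by positivity)] at hpt2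
    rw [hk]
    simp only [hh]
    calc _ = F s * (ENNReal.ofReal (t ^ (a t + v t - 1)) * ENNReal.ofReal (s ^ (-(a s)))) := by ring
      _ ≤ F s * _ := mul_le_mul_right hpt2 _
      _ = _ := by ring
  calc _ ≤ ∫⁻ t in Ioi (0:ℝ), ENNReal.ofReal (Real.exp (3 * K * Q + K)) *
          (g t ^ q t * ENNReal.ofReal t⁻¹) := by
        apply setLIntegral_mono' measurableSet_Ioi
        intro t ht
        have ht : 0 < t := ht
        have hq1' : 0 ≤ q t := by linarith [h1q t]
        refine (ENNReal.rpow_le_rpow (hG t ht) hq1').trans ?_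
        rw [ENNReal.mul_rpow_of_nonneg _ _ hq1', ENNReal.ofReal_rpow_of_pos (by positivity)]
        rw [mul_left_comm, mul_comm, ← ENNReal.ofReal_mul (by positivity)]
        gcongr
        have hsi : t⁻¹ = Real.exp (- Real.log t) := by rw [Real.exp_neg, Real.exp_log ht]
        rw [hsi, Real.rpow_def_of_pos ht, ← Real.exp_add, ← Real.exp_add,
          ← Real.exp_mul]
        apply Real.exp_le_exp.2
        have hst : 1 ≤ stH q0 q1 t := stH_prop (fun x => 1 ≤ x) (by linarith) (by linarith) t
        have := log_bound (c := - (1 / stH q0 q1 t)) (hqK t ht) (by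
            rw [abs_neg, abs_of_nonneg (by positivity), div_le_one (by linarith)]; exact hst)
        have h3 : 3 * K * q t ≤ 3 * K * Q := by
          apply mul_le_mul_of_nonneg_left (hqQ t); positivity
        have e : -(1 / stH q0 q1 t) * ((q t - stH q0 q1 t) * Real.log t) =
          Real.log t * -(1 / stH q0 q1 t) * q t + Real.log t := by field_simp; ring
        rw [e] at this
        nlinarith
    _ = ENNReal.ofReal (Real.exp (3 * K * Q + K)) * ∫⁻ t, g t ^ q t ∂muH := by
        rw [lintegral_const_mul' _ _ ENNReal.ofReal_ne_top, lintegral_muH (mg.pow hqm)]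
    _ ≤ _ := by gcongr

lemma classP_log {ℓ : ℝ≥0∞} {p : ℝ → ℝ} {p0 pinf : ℝ} (h : ClassP ℓ p p0 pinf) :
    ∃ K : ℝ, ∀ t, 0 < t → ENNReal.ofReal t < ℓ →
      |p t - stH p0 (if ℓ = ∞ then pinf else p0) t| * |Real.log t| ≤ K := by
  obtain ⟨M, hM⟩ := h.bounded
  obtain ⟨C0, hC0, hd0⟩ := h.decay_zero
  obtain ⟨C1, hC1, hd1⟩ : ∃ C1 : ℝ, 0 < C1 ∧ (ℓ = ∞ → ∀ t : ℝ, 0 ≤ t →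
      |p t - pinf| ≤ C1 / Real.log (Real.exp 1 + t)) := by
    by_cases hl : ℓ = ∞
    · obtain ⟨C, hC, hd⟩ := h.decay_infty hl
      exact ⟨C, hC, fun _ => hd⟩
    · exact ⟨1, one_pos, fun h => absurd h hl⟩
  have hM0 : 0 ≤ M := (abs_nonneg _).trans (hM 0 le_rfl (by simp))
  have hl2 : 0 ≤ Real.log 2 := Real.log_nonneg (by norm_num)
  have hX : 0 ≤ (M + |p0|) * (Real.log 2 + |Real.log ℓ.toReal|) := by positivity
  refine ⟨C0 + (M + |p0|) * (Real.log 2 + |Real.log ℓ.toReal|) + C1, ?_⟩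
  intro t ht htl
  have hdiff : |p t - p0| ≤ M + |p0| :=
    (abs_sub _ _).trans (add_le_add_left (hM t ht.le htl.le) _)
  rcases le_or_gt t (1/2) with h1 | h1
  · have : t ≤ 1 := by linarith
    simp only [stH, this, if_true]
    have hd := hd0 t ht h1
    have hlog : 0 < Real.log (1 / t) := Real.log_pos (by rw [lt_div_iff₀ ht]; linarith)
    rw [le_div_iff₀ hlog] at hd
    have : |Real.log t| = Real.log (1 / t) := by
      rw [one_div, Real.log_inv] at *
      rw [abs_of_neg (by linarith)]
    rw [this]
    linarith
  · rcases le_or_gt t 1 with h2 | h2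
    · simp only [stH, h2, if_true]
      have hlog : |Real.log t| ≤ Real.log 2 := by
        rw [abs_of_nonpos (Real.log_nonpos ht.le h2), ← Real.log_inv]
        apply Real.log_le_log (by positivity)
        rw [inv_le_comm₀ ht (by norm_num)]; linarith
      have : |p t - p0| * |Real.log t| ≤ (M + |p0|) * (Real.log 2 + |Real.log ℓ.toReal|) := by
        apply mul_le_mul hdiff _ (abs_nonneg _) (by positivity)
        linarith [abs_nonneg (Real.log ℓ.toReal)]
      linarith
    · simp only [stH, not_le.2 h2, if_false]
      have hlt : 0 ≤ Real.log t := Real.log_nonneg h2.le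
      by_cases hl : ℓ = ∞
      · simp only [hl, if_true]
        have hd := hd1 hl t ht.le
        have he := Real.exp_pos 1
        have hlog : 0 < Real.log (Real.exp 1 + t) := Real.log_pos (by linarith)
        rw [le_div_iff₀ hlog] at hd
        have hle : Real.log t ≤ Real.log (Real.exp 1 + t) := Real.log_le_log ht (by linarith)
        rw [abs_of_nonneg hlt]
        have := mul_le_mul_of_nonneg_left hle (abs_nonneg (p t - pinf))
        rw [hl] at hX
        linarith
      · simp only [hl, if_false]
        have hlog : |Real.log t| ≤ |Real.log ℓ.toReal| := by
          rw [abs_of_nonneg hlt]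
          refine le_trans (Real.log_le_log ht ?_) (le_abs_self _)
          exact ((ENNReal.ofReal_lt_iff_lt_toReal ht.le hl).1 htl).le
        have : |p t - p0| * |Real.log t| ≤ (M + |p0|) * (Real.log 2 + |Real.log ℓ.toReal|) := by
          apply mul_le_mul hdiff _ (abs_nonneg _) (by positivity)
          linarith [abs_nonneg (Real.log ℓ.toReal)]
        linarith

lemma exists_deltaH {ℓ : ℝ≥0∞} (hℓ : 0 < ℓ) : ∃ δ : ℝ, 0 < δ ∧ δ ≤ 1 ∧ ENNReal.ofReal δ ≤ ℓ := by
  have hne : min ℓ 1 ≠ ∞ := ne_top_of_le_ne_top ENNReal.one_ne_top (min_le_right _ _)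
  refine ⟨(min ℓ 1).toReal, ENNReal.toReal_pos (lt_min hℓ one_pos).ne' hne, ?_, ?_⟩
  · have := ENNReal.toReal_mono ENNReal.one_ne_top (min_le_right ℓ 1)
    simpa using this
  · rw [ENNReal.ofReal_toReal hne]; exact min_le_left _ _

lemma classPa_bounds {ℓ : ℝ≥0∞} (hℓ : 0 < ℓ) {p : ℝ → ℝ} {p0 pinf : ℝ}
    (h : ClassPa 1 ℓ p p0 pinf) :
    ∃ Q : ℝ, (∀ t : ℝ, 0 < t → ENNReal.ofReal t < ℓ → 1 ≤ p t ∧ p t ≤ Q) ∧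
      (1 < p0 ∧ p0 ≤ Q) ∧ (1 < (if ℓ = ∞ then pinf else p0) ∧ (if ℓ = ∞ then pinf else p0) ≤ Q) := by
  obtain ⟨hP, pm, pM, h1, hb⟩ := h
  have z : 1 < p0 ∧ p0 ≤ pM := by
    obtain ⟨δ, hδ, _, hδℓ⟩ := exists_deltaH hℓ
    have hev : ∀ᶠ t in 𝓝[>] (0:ℝ), pm ≤ p t ∧ p t ≤ pM := by
      filter_upwards [Ioo_mem_nhdsGT hδ] with t ht
      exact hb t ht.1.le ((ENNReal.ofReal_le_ofReal ht.2.le).trans hδℓ)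
    exact ⟨h1.trans_le (ge_of_tendsto hP.lim_zero (hev.mono fun _ h => h.1)),
      le_of_tendsto hP.lim_zero (hev.mono fun _ h => h.2)⟩
  refine ⟨pM, fun t ht htl => ?_, z, ?_⟩
  · have := hb t ht.le htl.le
    exact ⟨by linarith, this.2⟩
  · by_cases hl : ℓ = ∞
    · simp only [hl, if_true]
      have hev : ∀ᶠ t in atTop, pm ≤ p t ∧ p t ≤ pM := by
        filter_upwards [eventually_ge_atTop (0:ℝ)] with t ht
        exact hb t ht (by simp [hl])
      exact ⟨h1.trans_le (ge_of_tendsto (hP.lim_infty hl) (hev.mono fun _ h => h.1)),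
        le_of_tendsto (hP.lim_infty hl) (hev.mono fun _ h => h.2)⟩
    · simpa only [hl, if_false] using z

lemma suffH {ℓ : ℝ≥0∞} {p q a v : ℝ → ℝ} {p0 p1 q0 q1 a0 a1 v0 v1 K Q : ℝ}
    (hpm : Measurable p) (hqm : Measurable q)
    (h1p : ∀ t : ℝ, 0 < t → ENNReal.ofReal t < ℓ → 1 ≤ p t)
    (h1q : ∀ t : ℝ, 0 < t → ENNReal.ofReal t < ℓ → 1 ≤ q t)
    (hqQ : ∀ t : ℝ, 0 < t → ENNReal.ofReal t < ℓ → q t ≤ Q)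
    (hp0 : 1 ≤ p0) (hp1 : 1 ≤ p1) (hp0Q : p0 ≤ Q) (hp1Q : p1 ≤ Q) (hpq0 : p0 ≤ q0) (hpq1 : p1 ≤ q1)
    (hq0Q : q0 ≤ Q) (hq1Q : q1 ≤ Q) (hK0 : 0 ≤ K)
    (hpK : ∀ t, 0 < t → ENNReal.ofReal t < ℓ → |p t - stH p0 p1 t| * |Real.log t| ≤ K)
    (hqK : ∀ t, 0 < t → ENNReal.ofReal t < ℓ → |q t - stH q0 q1 t| * |Real.log t| ≤ K)
    (haK : ∀ t, 0 < t → ENNReal.ofReal t < ℓ → |a t - stH a0 a1 t| * |Real.log t| ≤ K)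
    (hvK : ∀ t, 0 < t → ENNReal.ofReal t < ℓ → |v t - stH v0 v1 t| * |Real.log t| ≤ K)
    (ha0 : a0 < 1 - 1 / p0) (ha1 : a1 < 1 - 1 / p1)
    (hq0 : 1 / q0 = 1 / p0 - v0) (hq1 : 1 / q1 = 1 / p1 - v1) :
    ∃ C : ℝ≥0∞, 0 < C ∧ C < ∞ ∧ ∀ f : ℝ → ℝ, Measurable f → (∀ t, 0 ≤ f t) →
        luxNorm ℓ p f < ∞ →
        luxNorm ℓ q (fun t => t ^ (a t + v t - 1) * ∫ s in Ioo (0 : ℝ) t, f s / s ^ a s)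
          ≤ C * luxNorm ℓ p f := by
  classical
  set D : Set ℝ := {t : ℝ | 0 < t ∧ ENNReal.ofReal t < ℓ} with hD
  have mD : MeasurableSet D :=
    (measurableSet_lt measurable_const measurable_id).inter
      (measurableSet_lt ENNReal.measurable_ofReal measurable_const)
  have mst : ∀ c d : ℝ, Measurable (stH c d) := fun c d => by
    unfold stH
    exact Measurable.ite measurableSet_Iic measurable_const measurable_const
  have ext1 : ∀ (x : ℝ → ℝ) (c d : ℝ), 
      (∀ t, 0 < t → ENNReal.ofReal t < ℓ → |x t - stH c d t| * |Real.log t| ≤ K) →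
      ∀ t, 0 < t → |(if t ∈ D then x t else stH c d t) - stH c d t| * |Real.log t| ≤ K := by
    intro x c d h t ht
    split_ifs with h'
    · exact h t h'.1 h'.2
    · simpa using hK0
  obtain ⟨B, hB, hmain⟩ := mainH (p := fun t => if t ∈ D then p t else stH p0 p1 t)
    (q := fun t => if t ∈ D then q t else stH q0 q1 t)
    (a := fun t => if t ∈ D then a t else stH a0 a1 t)
    (v := fun t => if t ∈ D then v t else stH v0 v1 t) (Q := Q)
    (Measurable.ite mD hpm (mst _ _)) (Measurable.ite mD hqm (mst _ _))
    (fun t => by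
      split_ifs with h
      · exact h1p t h.1 h.2
      · exact stH_prop (fun x => 1 ≤ x) hp0 hp1 t)
    (fun t => by
      split_ifs with h
      · exact h1q t h.1 h.2
      · exact stH_prop (fun x => 1 ≤ x) (by linarith) (by linarith) t)
    (fun t => by
      split_ifs with h
      · exact hqQ t h.1 h.2
      · exact stH_prop (fun x => x ≤ Q) hq0Q hq1Q t)
    hp0 hp1 hp0Q hp1Q hpq0 hpq1 (ext1 _ _ _ hpK) (ext1 _ _ _ hqK) (ext1 _ _ _ haK) (ext1 _ _ _ hvK)
    ha0 ha1 hq0 hq1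
  set C : ℝ≥0∞ := max B 1 with hC
  have hC1 : 1 ≤ C := le_max_right _ _
  have hCt : C < ∞ := max_lt hB ENNReal.one_lt_top
  have hC0 : C ≠ 0 := (one_pos.trans_le hC1).ne'
  refine ⟨C, one_pos.trans_le hC1, hCt, ?_⟩
  intro f hf hf0 _
  rw [mul_comm, ← ENNReal.div_le_iff hC0 hCt.ne]
  apply le_sInf
  rintro lam ⟨hl0, hlam⟩
  rcases eq_or_ne lam ∞ with rfl | hlt
  · exact le_top
  rw [ENNReal.div_le_iff hC0 hCt.ne]
  apply sInf_le
  refine ⟨ENNReal.mul_pos hl0.ne' hC0, ?_⟩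
  set F : ℝ → ℝ≥0∞ := D.indicator (fun t => ENNReal.ofReal |f t| / lam) with hF
  have mF : Measurable F := by
    apply Measurable.indicator _ mD
    exact (hf.norm.ennreal_ofReal).div_const _
  have hDsub : D ⊆ Ioi 0 := fun t ht => ht.1
  have hFint : ∫⁻ s in Ioi (0:ℝ), F s ^ (if s ∈ D then p s else stH p0 p1 s) ≤ 1 := by
    refine le_trans (le_of_eq ?_) hlam
    have : ∀ s, F s ^ (if s ∈ D then p s else stH p0 p1 s) =
        D.indicator (fun t => (ENNReal.ofReal |f t| / lam) ^ p t) s := by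
      intro s
      by_cases h : s ∈ D
      · simp [hF, h]
      · have : 0 < stH p0 p1 s := stH_prop (fun x => 0 < x) (by linarith) (by linarith) s
        simp [hF, h, this]
    simp_rw [this]
    rw [setLIntegral_indicator mD, inter_eq_left.2 hDsub]
  have hres := hmain F mF hFint
  calc _ ≤ ∫⁻ t in D, C⁻¹ * (ENNReal.ofReal (t ^ ((if t ∈ D then a t else stH a0 a1 t) +
          (if t ∈ D then v t else stH v0 v1 t) - 1)) *
        ∫⁻ s in Ioo 0 t, F s * ENNReal.ofReal (s ^ (-(if s ∈ D then a s else stH a0 a1 s)))) ^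
          (if t ∈ D then q t else stH q0 q1 t) := by
        apply setLIntegral_mono' mD
        intro t ht
        have ht0 : 0 < t := ht.1
        have hq1' := h1q t ht.1 ht.2
        simp only [ht, if_true]
        set X := ENNReal.ofReal (t ^ (a t + v t - 1)) *
          ∫⁻ s in Ioo 0 t, F s * ENNReal.ofReal (s ^ (-(if s ∈ D then a s else stH a0 a1 s))) with hX
        have step : ENNReal.ofReal |t ^ (a t + v t - 1) * ∫ s in Ioo (0 : ℝ) t, f s / s ^ a s| ≤
            lam * X := by
          have hnn : 0 ≤ ∫ s in Ioo (0 : ℝ) t, f s / s ^ a s := by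
            apply setIntegral_nonneg measurableSet_Ioo
            intro s hs
            have := hs.1
            have := hf0 s
            positivity
          rw [abs_of_nonneg (by positivity), ENNReal.ofReal_mul (by positivity), hX, mul_left_comm]
          gcongr
          rw [← lintegral_const_mul' _ _ hlt]
          calc ENNReal.ofReal (∫ s in Ioo (0 : ℝ) t, f s / s ^ a s) 
              ≤ ∫⁻ s in Ioo (0 : ℝ) t, ENNReal.ofReal (f s / s ^ a s) := by
                by_cases hi : IntegrableOn (fun s => f s / s ^ a s) (Ioo 0 t)
                · rw [ofReal_integral_eq_lintegral_ofReal hi]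
                  filter_upwards [ae_restrict_mem measurableSet_Ioo] with s hs
                  have := hs.1
                  have := hf0 s
                  positivity
                · rw [integral_undef hi]; simp
            _ ≤ _ := by
                apply setLIntegral_mono' measurableSet_Ioo
                intro s hs
                have hs0 := hs.1
                have hsD : s ∈ D := ⟨hs.1, (ENNReal.ofReal_le_ofReal hs.2.le).trans_lt ht.2⟩
                simp only [hF, hsD, if_true, indicator_of_mem]
                rw [← mul_assoc, ENNReal.mul_div_cancel hl0.ne' hlt, abs_of_nonneg (hf0 s),
                  ← ENNReal.ofReal_mul (hf0 s), Real.rpow_neg hs0.le, div_eq_mul_inv]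
        calc _ ≤ (X / C) ^ q t := by
              apply ENNReal.rpow_le_rpow _ (by linarith)
              calc _ ≤ (lam * X) / (lam * C) := by gcongr
                _ = X / C := ENNReal.mul_div_mul_left _ _ hl0.ne' hlt
          _ = (C⁻¹) ^ q t * X ^ q t := by
              rw [div_eq_mul_inv, mul_comm, ENNReal.mul_rpow_of_nonneg _ _ (by linarith)]
          _ ≤ _ := by
              gcongr
              calc _ ≤ (C⁻¹) ^ (1:ℝ) :=
                    ENNReal.rpow_le_rpow_of_exponent_ge (ENNReal.inv_le_one.2 hC1) hq1'
                _ = _ := by simp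
    _ = C⁻¹ * _ := lintegral_const_mul' _ _ (ENNReal.inv_ne_top.2 hC0)
    _ ≤ C⁻¹ * C := by
        gcongr
        refine (lintegral_mono_set hDsub).trans (hres.trans (le_max_left _ _))
    _ = 1 := ENNReal.inv_mul_cancel hC0 hCt.ne

lemma necH {ℓ : ℝ≥0∞} {p q a v : ℝ → ℝ} {P0 Q0 A0 V0 K Q ε T : ℝ} {C : ℝ≥0∞}
    (ham : Measurable a)
    (h1p : ∀ t : ℝ, 0 < t → ENNReal.ofReal t < ℓ → 1 ≤ p t)
    (h1q : ∀ t : ℝ, 0 < t → ENNReal.ofReal t < ℓ → 1 ≤ q t)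
    (hqQ : ∀ t : ℝ, 0 < t → ENNReal.ofReal t < ℓ → q t ≤ Q)
    (hε : 0 < ε) (hεT : 2 * ε < T) (hTℓ : ∀ t, t < T → ENNReal.ofReal t < ℓ)
    (hP0 : 1 ≤ P0) (hQ0 : 1 ≤ Q0) (hK0 : 0 ≤ K) (hCt : C < ∞)
    (hpK : ∀ t, ε < t → t < T → |p t - P0| * |Real.log t| ≤ K)
    (hqK : ∀ t, ε < t → t < T → |q t - Q0| * |Real.log t| ≤ K)
    (haK : ∀ t, ε < t → t < T → |a t - A0| * |Real.log t| ≤ K)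
    (hvK : ∀ t, ε < t → t < T → |v t - V0| * |Real.log t| ≤ K)
    (hb : 1 - 1 / P0 ≤ A0) (hQP : 1 / Q0 = 1 / P0 - V0)
    (H : ∀ f : ℝ → ℝ, Measurable f → (∀ t, 0 ≤ f t) →
        luxNorm ℓ p f < ∞ →
        luxNorm ℓ q (fun t => t ^ (a t + v t - 1) * ∫ s in Ioo (0 : ℝ) t, f s / s ^ a s)
          ≤ C * luxNorm ℓ p f) :
    ((Real.exp (-3 * K) / 2) / (C.toReal * Real.exp K + 1)) ^ Q * Real.exp (-K) *
      Real.log (T / (2 * ε)) ≤ 1 := by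
  set f : ℝ → ℝ := (Ioo ε (2 * ε)).indicator (fun s => s ^ (-(1 / P0))) with hf
  have hP0' : 0 < P0 := by linarith
  have hQ0' : 0 < Q0 := by linarith
  have hPi : 1 / P0 ≤ 1 := by rw [div_le_one hP0']; exact hP0
  have hQi : 1 / Q0 ≤ 1 := by rw [div_le_one hQ0']; exact hQ0
  have mf : Measurable f := (measurable_id.pow_const _).indicator measurableSet_Ioo
  have f0 : ∀ t, 0 ≤ f t := by
    intro t
    apply indicator_nonneg
    intro s hs
    have : 0 < s := hε.trans hs.1
    positivity
  have mD : MeasurableSet {t : ℝ | 0 < t ∧ ENNReal.ofReal t < ℓ} :=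
    (measurableSet_lt measurable_const measurable_id).inter
      (measurableSet_lt ENNReal.measurable_ofReal measurable_const)
  have hlux : luxNorm ℓ p f ≤ ENNReal.ofReal (Real.exp K) := by
    apply sInf_le
    refine ⟨by simp [Real.exp_pos], ?_⟩
    calc _ ≤ ∫⁻ t in {t : ℝ | 0 < t ∧ ENNReal.ofReal t < ℓ},
          (Ioo ε (2 * ε)).indicator (fun _ => ENNReal.ofReal ε⁻¹) t := by
          apply setLIntegral_mono' mD
          intro t ht
          have hp1 := h1p t ht.1 ht.2
          by_cases h : t ∈ Ioo ε (2 * ε)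
          · have ht0 : 0 < t := ht.1
            simp only [hf, h, indicator_of_mem]
            rw [abs_of_nonneg (by positivity), ← ENNReal.ofReal_div_of_pos (Real.exp_pos _),
              ENNReal.ofReal_rpow_of_pos (by positivity)]
            apply ENNReal.ofReal_le_ofReal
            calc _ ≤ t⁻¹ := by
                  have hsi : t⁻¹ = Real.exp (- Real.log t) := by rw [Real.exp_neg, Real.exp_log ht0]
                  rw [hsi, Real.rpow_def_of_pos ht0, ← Real.exp_sub, ← Real.exp_mul]
                  apply Real.exp_le_exp.2
                  have b := log_bound (c := - (1 / P0)) (hpK t h.1 (h.2.trans hεT))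
                    (by rw [abs_neg, abs_of_nonneg (by positivity)]; exact hPi)
                  have e : -(1 / P0) * ((p t - P0) * Real.log t) =
                    Real.log t * -(1 / P0) * p t + Real.log t := by field_simp; ring
                  rw [e] at b
                  nlinarith [mul_le_mul_of_nonneg_left hp1 hK0]
              _ ≤ _ := by
                  apply inv_anti₀ hε h.1.le
          · have : 0 < p t := by linarith
            simp [hf, h, this]
      _ ≤ ∫⁻ t, (Ioo ε (2 * ε)).indicator (fun _ => ENNReal.ofReal ε⁻¹) t := setLIntegral_le_lintegral _ _
      _ = 1 := by
          rw [lintegral_indicator measurableSet_Ioo, setLIntegral_const, Real.volume_Ioo,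
            ← ENNReal.ofReal_mul (by positivity)]
          have : ε⁻¹ * (2 * ε - ε) = 1 := by field_simp; ring
          rw [this, ENNReal.ofReal_one]
  have hG := H f mf f0 (hlux.trans_lt ENNReal.ofReal_lt_top)
  set Lam : ℝ := C.toReal * Real.exp K + 1 with hLam
  have hLam1 : 1 ≤ Lam := by
    have : 0 ≤ C.toReal * Real.exp K := by positivity
    linarith
  have hLam0 : 0 < Lam := by linarith
  have hGl : luxNorm ℓ q (fun t => t ^ (a t + v t - 1) * ∫ s in Ioo (0 : ℝ) t, f s / s ^ a s)
      < ENNReal.ofReal Lam := by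
    refine lt_of_le_of_lt (hG.trans (mul_le_mul_right hlux C)) ?_
    rw [← ENNReal.ofReal_toReal hCt.ne, ← ENNReal.ofReal_mul (by positivity)]
    rw [ENNReal.ofReal_lt_ofReal_iff hLam0]
    linarith
  obtain ⟨lam, ⟨hl0, hlam⟩, hll⟩ := sInf_lt_iff.1 hGl
  set c : ℝ := Real.exp (-3 * K) / 2 with hc
  have hc0 : 0 < c := by positivity
  have hc1 : c ≤ 1 := by
    have : Real.exp (-3 * K) ≤ 1 := Real.exp_le_one_iff.2 (by linarith)
    rw [hc]; linarith
  have hcl1 : c / Lam ≤ 1 := by rw [div_le_one hLam0]; linarith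
  -- lower bound for the Hardy operator
  have hlow : ∀ t, 2 * ε < t → t < T → c * t ^ (-(1 / Q0)) ≤
      t ^ (a t + v t - 1) * ∫ s in Ioo (0 : ℝ) t, f s / s ^ a s := by
    intro t ht1 ht2
    have ht0 : 0 < t := by linarith
    have hI : ∫ s in Ioo (0 : ℝ) t, f s / s ^ a s =
        ∫ s in Ioo ε (2 * ε), s ^ (-(1 / P0)) / s ^ a s := by
      have e : ∀ s, f s / s ^ a s =
          (Ioo ε (2 * ε)).indicator (fun s => s ^ (-(1 / P0)) / s ^ a s) s := by
        intro s
        by_cases h : s ∈ Ioo ε (2 * ε)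
        · simp [hf, h]
        · simp [hf, h]
      simp_rw [e]
      rw [setIntegral_indicator measurableSet_Ioo]
      congr 2
      apply inter_eq_right.2
      intro s hs
      exact ⟨hε.trans hs.1, hs.2.trans ht1⟩
    have hexp : ∀ s, s ∈ Ioo ε (2 * ε) → s ^ (-(1 / P0)) / s ^ a s =
        Real.exp (-(A0 + 1 / P0 - 1) * Real.log s) * s⁻¹ * Real.exp (- ((a s - A0) * Real.log s)) := by
      intro s hs
      have hs0 : 0 < s := hε.trans hs.1
      have hsi : s⁻¹ = Real.exp (- Real.log s) := by rw [Real.exp_neg, Real.exp_log hs0]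
      rw [hsi, Real.rpow_def_of_pos hs0, Real.rpow_def_of_pos hs0, ← Real.exp_sub,
        ← Real.exp_add, ← Real.exp_add]
      congr 1
      ring
    have hintg : IntegrableOn (fun s : ℝ => s ^ (-(1 / P0)) / s ^ a s) (Ioo ε (2 * ε)) := by
      apply Measure.integrableOn_of_bounded (M := Real.exp (-(A0 + 1 / P0 - 1) * Real.log ε) * ε⁻¹ *
        Real.exp K)
      · simp
      · exact ((measurable_id.pow_const _).div (measurable_id.pow ham)).aestronglyMeasurable
      · filter_upwards [ae_restrict_mem measurableSet_Ioo] with s hs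
        have hs0 : 0 < s := hε.trans hs.1
        rw [Real.norm_of_nonneg (by positivity), hexp s hs]
        have hl : Real.log ε ≤ Real.log s := Real.log_le_log hε hs.1.le
        have b := log_bound (c := -1) (haK s hs.1 (hs.2.trans hεT)) (by simp)
        gcongr ?_ * ?_ * ?_
        · apply Real.exp_le_exp.2
          nlinarith
        · exact inv_anti₀ hε hs.1.le
        · apply Real.exp_le_exp.2
          linarith
    have hge := setIntegral_ge_of_const_le (μ := volume) (s := Ioo ε (2 * ε))
      (f := fun s : ℝ => s ^ (-(1 / P0)) / s ^ a s)
      (c := Real.exp (-(A0 + 1 / P0 - 1) * Real.log t) * (2 * ε)⁻¹ * Real.exp (-K))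
      measurableSet_Ioo (by simp) (by
        intro s hs
        have hs0 : 0 < s := hε.trans hs.1
        rw [hexp s hs]
        have hl : Real.log s ≤ Real.log t := Real.log_le_log hs0 (hs.2.trans ht1).le
        have b := log_bound (c := 1) (haK s hs.1 (hs.2.trans hεT)) (by simp)
        gcongr ?_ * ?_ * ?_
        · apply Real.exp_le_exp.2
          nlinarith
        · exact inv_anti₀ hs0 hs.2.le
        · apply Real.exp_le_exp.2
          linarith) hintg
    have hvol : volume.real (Ioo ε (2 * ε)) = ε := by
      rw [Real.volume_real_Ioo_of_le (by linarith)]; ring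
    rw [hvol, smul_eq_mul] at hge
    rw [hI]
    have e2 : ε * (Real.exp (-(A0 + 1 / P0 - 1) * Real.log t) * (2 * ε)⁻¹ * Real.exp (-K)) =
        Real.exp (-(A0 + 1 / P0 - 1) * Real.log t - K) / 2 := by
      rw [Real.exp_sub, Real.exp_neg K]
      generalize Real.exp (-(A0 + 1 / P0 - 1) * Real.log t) = X
      field_simp
    rw [e2] at hge
    refine le_trans ?_ (mul_le_mul_of_nonneg_left hge (by positivity))
    have hεt : ε < t := by linarith
    have b2 := log_bound (c := -1) (haK t hεt ht2) (by simp)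
    have b3 := log_bound (c := -1) (hvK t hεt ht2) (by simp)
    rw [hc, div_mul_eq_mul_div, mul_div_assoc']
    gcongr ?_ / 2
    rw [Real.rpow_def_of_pos ht0, Real.rpow_def_of_pos ht0, ← Real.exp_add, ← Real.exp_add]
    apply Real.exp_le_exp.2
    rw [hQP]
    nlinarith
  have hTpos : 0 < T := by linarith
  have hκ : 0 ≤ (c / Lam) ^ Q * Real.exp (-K) := by positivity
  have hmod : ∫⁻ t in Ioo (2 * ε) T, ENNReal.ofReal ((c / Lam) ^ Q * Real.exp (-K) * t⁻¹) ≤ 1 := by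
    refine le_trans ?_ hlam
    have hsub : Ioo (2 * ε) T ⊆ {t : ℝ | 0 < t ∧ ENNReal.ofReal t < ℓ} := by
      intro t ht
      exact ⟨by linarith [ht.1], hTℓ t ht.2⟩
    refine le_trans ?_ (lintegral_mono_set hsub)
    apply setLIntegral_mono' measurableSet_Ioo
    intro t ht
    have ht0 : 0 < t := by linarith [ht.1]
    have hl := hlow t ht.1 ht.2
    have h1 := h1q t ht0 (hTℓ t ht.2)
    have h2 := hqQ t ht0 (hTℓ t ht.2)
    have hεt : ε < t := by linarith [ht.1]
    calc _ ≤ ENNReal.ofReal ((c * t ^ (-(1 / Q0)) / Lam) ^ q t) := by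
          apply ENNReal.ofReal_le_ofReal
          have e : c * t ^ (-(1 / Q0)) / Lam = (c / Lam) * t ^ (-(1 / Q0)) := by ring
          rw [e, Real.mul_rpow (by positivity) (by positivity), mul_assoc]
          gcongr ?_ * ?_
          · exact Real.rpow_le_rpow_of_exponent_ge (by positivity) hcl1 h2
          · have hsi : t⁻¹ = Real.exp (- Real.log t) := by rw [Real.exp_neg, Real.exp_log ht0]
            rw [hsi, Real.rpow_def_of_pos ht0, ← Real.exp_add, ← Real.exp_mul]
            apply Real.exp_le_exp.2
            have b := log_bound (c := 1 / Q0) (hqK t hεt ht.2)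
              (by rw [abs_of_nonneg (by positivity)]; exact hQi)
            have e : (1 / Q0) * ((q t - Q0) * Real.log t) =
              - (Real.log t * -(1 / Q0) * q t) - Real.log t := by field_simp
            rw [e] at b
            linarith
      _ = (ENNReal.ofReal (c * t ^ (-(1 / Q0))) / ENNReal.ofReal Lam) ^ q t := by
          rw [← ENNReal.ofReal_div_of_pos hLam0, ENNReal.ofReal_rpow_of_pos (by positivity)]
      _ ≤ _ := by
          apply ENNReal.rpow_le_rpow _ (by linarith)
          gcongr
          exact hl.trans (le_abs_self _)
  have hlogint : ∫⁻ t in Ioo (2 * ε) T, ENNReal.ofReal ((c / Lam) ^ Q * Real.exp (-K) * t⁻¹) =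
      ENNReal.ofReal ((c / Lam) ^ Q * Real.exp (-K) * Real.log (T / (2 * ε))) := by
    have h2ε : 0 < 2 * ε := by linarith
    have hii : IntervalIntegrable (fun t : ℝ => t⁻¹) volume (2 * ε) T := by
      apply intervalIntegral.intervalIntegrable_inv (f := fun x => x)
      · intro x hx
        rw [uIcc_of_le hεT.le] at hx
        linarith [hx.1]
      · exact continuousOn_id
    rw [← ofReal_integral_eq_lintegral_ofReal]
    · rw [integral_const_mul, ← integral_Ioc_eq_integral_Ioo,
        ← intervalIntegral.integral_of_le hεT.le, integral_inv_of_pos h2ε hTpos]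
    · rw [intervalIntegrable_iff_integrableOn_Ioo_of_le hεT.le] at hii
      exact hii.const_mul _
    · filter_upwards [ae_restrict_mem measurableSet_Ioo] with t ht
      have ht0 : 0 < t := by linarith [ht.1]
      positivity
  rw [hlogint] at hmod
  rw [← ENNReal.ofReal_one] at hmod
  exact (ENNReal.ofReal_le_ofReal_iff one_pos.le).1 hmod

/-- Theorem 2.2, first Hardy inequality.  For `p ∈ P₁([0,ℓ])`,
`α, ν ∈ P([0,ℓ])` with `0 ≤ ν(0) < 1/p(0)` (and at `∞` if `ℓ = ∞`), and `q ∈ P₁([0,ℓ])`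
with `1/q(0) = 1/p(0) − ν(0)` (and at `∞` if `ℓ = ∞`), the Hardy inequality
`‖t^{α(t)+ν(t)−1} ∫₀ᵗ f(s) s^{−α(s)} ds‖_{q(·)} ≤ C ‖f‖_{p(·)}` holds for all nonnegative
`f ∈ L^{p(·)}([0,ℓ])` iff `α(0) < 1/p′(0)` (and `α(∞) < 1/p′(∞)` if `ℓ = ∞`). -/
theorem statement0 (ℓ : ℝ≥0∞) (hℓ : 0 < ℓ)
    (p q a v : ℝ → ℝ) (p0 pinf q0 qinf a0 ainf v0 vinf : ℝ)
    (hp : ClassPa 1 ℓ p p0 pinf) (hq : ClassPa 1 ℓ q q0 qinf)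
    (ha : ClassP ℓ a a0 ainf) (hv : ClassP ℓ v v0 vinf)
    (hv0 : 0 ≤ v0 ∧ v0 < 1 / p0)
    (hvinf : ℓ = ∞ → 0 ≤ vinf ∧ vinf < 1 / pinf)
    (hq0 : 1 / q0 = 1 / p0 - v0)
    (hqinf : ℓ = ∞ → 1 / qinf = 1 / pinf - vinf) :
    (∃ C : ℝ≥0∞, 0 < C ∧ C < ∞ ∧ ∀ f : ℝ → ℝ, Measurable f → (∀ t, 0 ≤ f t) →
        luxNorm ℓ p f < ∞ →
        luxNorm ℓ q (fun t => t ^ (a t + v t - 1) * ∫ s in Ioo (0 : ℝ) t, f s / s ^ a s)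
          ≤ C * luxNorm ℓ p f) ↔
      (a0 < 1 - 1 / p0 ∧ (ℓ = ∞ → ainf < 1 - 1 / pinf)) := by
  classical
  obtain ⟨Kp, hKp⟩ := classP_log hp.1
  obtain ⟨Kq, hKq⟩ := classP_log hq.1
  obtain ⟨Ka, hKa⟩ := classP_log ha
  obtain ⟨Kv, hKv⟩ := classP_log hv
  obtain ⟨Qp, hbp, hbp0, hbp1⟩ := classPa_bounds hℓ hp
  obtain ⟨Qq, hbq, hbq0, hbq1⟩ := classPa_bounds hℓ hq
  set p1 := if ℓ = ∞ then pinf else p0 with hp1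
  set q1 := if ℓ = ∞ then qinf else q0 with hq1
  set a1 := if ℓ = ∞ then ainf else a0 with ha1
  set v1 := if ℓ = ∞ then vinf else v0 with hv1
  have hqp1 : 1 / q1 = 1 / p1 - v1 := by
    by_cases hl : ℓ = ∞
    · simpa [hp1, hq1, hv1, hl] using hqinf hl
    · simpa [hp1, hq1, hv1, hl] using hq0
  have hv1n : 0 ≤ v1 := by
    by_cases hl : ℓ = ∞
    · simpa [hv1, hl] using (hvinf hl).1
    · simpa [hv1, hl] using hv0.1
  have hpq0 : p0 ≤ q0 := by
    have : 1 / q0 ≤ 1 / p0 := by linarith [hv0.1]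
    exact (one_div_le_one_div (by linarith) (by linarith)).1 this
  have hpq1 : p1 ≤ q1 := by
    have : 1 / q1 ≤ 1 / p1 := by linarith
    exact (one_div_le_one_div (by linarith) (by linarith)).1 this
  set K := max 0 (max (max Kp Kq) (max Ka Kv)) with hK
  have hK0 : 0 ≤ K := le_max_left _ _
  have k1 : Kp ≤ K := by simp [hK]
  have k2 : Kq ≤ K := by simp [hK]
  have k3 : Ka ≤ K := by simp [hK]
  have k4 : Kv ≤ K := by simp [hK]
  constructor
  · rintro ⟨C, hC0, hCt, H⟩
    set κ : ℝ := ((Real.exp (-3 * K) / 2) / (C.toReal * Real.exp K + 1)) ^ Qq * Real.exp (-K) with hκ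
    have hκ0 : 0 < κ := by positivity
    have hX0 : 0 < 2 / κ := by positivity
    constructor
    · by_contra! hcon
      obtain ⟨δ, hδ, hδ1, hδℓ⟩ := exists_deltaH hℓ
      have he : Real.exp (-(2 / κ)) < 1 := by rw [Real.exp_lt_one_iff]; linarith
      have hTl : ∀ t, t < δ → ENNReal.ofReal t < ℓ := fun t ht =>
        lt_of_lt_of_le ((ENNReal.ofReal_lt_ofReal_iff hδ).2 ht) hδℓ
      have hε : 0 < δ / 2 * Real.exp (-(2 / κ)) := by positivity
      have hst : ∀ (c d : ℝ) {t : ℝ}, t < δ → stH c d t = c := fun c d t ht => by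
        simp [stH, (ht.trans_le hδ1).le]
      have hfin := necH (ε := δ / 2 * Real.exp (-(2 / κ))) (T := δ) (K := K) (Q := Qq)
        (P0 := p0) (Q0 := q0) (A0 := a0) (V0 := v0) ha.measurable
        (fun t h h' => (hbp t h h').1) (fun t h h' => (hbq t h h').1) (fun t h h' => (hbq t h h').2)
        hε (by nlinarith) hTl hbp0.1.le hbq0.1.le hK0 hCt
        (fun t h h' => by
          have := hKp t (hε.trans h) (hTl t h'); rw [hst _ _ h'] at this; linarith)
        (fun t h h' => by
          have := hKq t (hε.trans h) (hTl t h'); rw [hst _ _ h'] at this; linarith)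
        (fun t h h' => by
          have := hKa t (hε.trans h) (hTl t h'); rw [hst _ _ h'] at this; linarith)
        (fun t h h' => by
          have := hKv t (hε.trans h) (hTl t h'); rw [hst _ _ h'] at this; linarith)
        hcon hq0 H
      have e : δ / (2 * (δ / 2 * Real.exp (-(2 / κ)))) = Real.exp (2 / κ) := by
        rw [Real.exp_neg]; field_simp
      rw [e, Real.log_exp, ← hκ, mul_div_cancel₀ _ hκ0.ne'] at hfin
      linarith
    · intro hl
      by_contra! hcon
      have hp1' : p1 = pinf := by simp [hp1, hl]
      have ha1' : a1 = ainf := by simp [ha1, hl]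
      rw [← hp1', ← ha1'] at hcon
      have he : 1 < Real.exp (2 / κ) := by rw [Real.one_lt_exp_iff]; linarith
      have hTl : ∀ t : ℝ, ENNReal.ofReal t < ℓ := fun t => by simp [hl]
      have hst : ∀ (c d : ℝ) {t : ℝ}, 1 < t → stH c d t = d := fun c d t ht => by
        simp [stH, ht]
      have hfin := necH (ε := 1) (T := 2 * Real.exp (2 / κ)) (K := K) (Q := Qq)
        (P0 := p1) (Q0 := q1) (A0 := a1) (V0 := v1) ha.measurable
        (fun t h h' => (hbp t h h').1) (fun t h h' => (hbq t h h').1) (fun t h h' => (hbq t h h').2)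
        one_pos (by linarith) (fun t _ => hTl t) hbp1.1.le hbq1.1.le hK0 hCt
        (fun t h h' => by
          have := hKp t (one_pos.trans h) (hTl t); rw [hst _ _ h] at this; linarith)
        (fun t h h' => by
          have := hKq t (one_pos.trans h) (hTl t); rw [hst _ _ h] at this; linarith)
        (fun t h h' => by
          have := hKa t (one_pos.trans h) (hTl t); rw [hst _ _ h] at this; linarith)
        (fun t h h' => by
          have := hKv t (one_pos.trans h) (hTl t); rw [hst _ _ h] at this; linarith)
        hcon hqp1 H
      have e : 2 * Real.exp (2 / κ) / (2 * 1) = Real.exp (2 / κ) := by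
        field_simp
      rw [e, Real.log_exp, ← hκ, mul_div_cancel₀ _ hκ0.ne'] at hfin
      linarith
  · rintro ⟨h0, hinf⟩
    have ha1p : a1 < 1 - 1 / p1 := by
      by_cases hl : ℓ = ∞
      · simpa [hp1, ha1, hl] using hinf hl
      · simpa [hp1, ha1, hl] using h0
    exact suffH (K := K) (Q := max Qp Qq) hp.1.measurable hq.1.measurable
      (fun t h h' => (hbp t h h').1) (fun t h h' => (hbq t h h').1)
      (fun t h h' => (hbq t h h').2.trans (le_max_right _ _)) hbp0.1.le hbp1.1.le
      (hbp0.2.trans (le_max_left _ _)) (hbp1.2.trans (le_max_left _ _)) hpq0 hpq1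
      (hbq0.2.trans (le_max_right _ _)) (hbq1.2.trans (le_max_right _ _)) hK0
      (fun t h h' => (hKp t h h').trans k1) (fun t h h' => (hKq t h h').trans k2)
      (fun t h h' => (hKa t h h').trans k3) (fun t h h' => (hKv t h h').trans k4)
      h0 ha1p hq0 hqp1

end
end

section
/- Let (T_τ)_{τ∈ℝ} be an ergodic flow of measure-preserving transformations on a σ-finite measure space (X,μ) and let f ∈ L¹(X,μ). Then the non-increasing rearrangement of the ergodic maximal function Mf(x) = sup_{a>0} (1/a) ∫₀^a |f(T_τ x)| dτ satisfies (Mf)*(t) ≤ f**(t) for all t > 0. -/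
open MeasureTheory Filter Set Metric
open scoped ENNReal NNReal Topology

noncomputable section

namespace S17

/-- Garsia's recursively defined maximal partial sums. -/
def garsia {X : Type*} (S : X → X) (h : X → ℝ≥0∞) (r : ℝ≥0∞) : ℕ → X → ℝ≥0∞
  | 0 => fun _ => 0
  | n + 1 => fun x => (h x + garsia S h r n (S x)) - r

variable {X : Type*} [MeasurableSpace X] {μ : Measure X}

lemma garsia_meas {S : X → X} (hS : Measurable S) {h : X → ℝ≥0∞} (hh : Measurable h) (r : ℝ≥0∞)
    (n : ℕ) : Measurable (garsia S h r n) := by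
  induction n with
  | zero => exact measurable_const
  | succ n ih => exact (hh.add (ih.comp hS)).sub measurable_const

lemma garsia_mono (S : X → X) (h : X → ℝ≥0∞) (r : ℝ≥0∞) (n : ℕ) (x : X) :
    garsia S h r n x ≤ garsia S h r (n + 1) x := by
  induction n generalizing x with
  | zero => exact zero_le
  | succ n ih =>
    change (h x + garsia S h r n (S x)) - r ≤ (h x + garsia S h r (n + 1) (S x)) - r
    gcongr
    exact ih _

lemma garsia_fin {S : X → X} (hS : MeasurePreserving S μ μ) {h : X → ℝ≥0∞} (hh : Measurable h)
    (hfin : ∫⁻ x, h x ∂μ ≠ ∞) (r : ℝ≥0∞) (n : ℕ) : ∫⁻ x, garsia S h r n x ∂μ ≠ ∞ := by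
  induction n with
  | zero => simp [garsia]
  | succ n ih =>
    have : ∫⁻ x, garsia S h r (n + 1) x ∂μ ≤ ∫⁻ x, (h x + garsia S h r n (S x)) ∂μ :=
      lintegral_mono fun x => tsub_le_self
    refine ne_top_of_le_ne_top ?_ this
    rw [lintegral_add_left hh, hS.lintegral_comp (garsia_meas hS.measurable hh r n)]
    exact ENNReal.add_ne_top.2 ⟨hfin, ih⟩

lemma garsia_sum (S : X → X) (h : X → ℝ≥0∞) (r : ℝ≥0∞) (n : ℕ) (x : X) :
    ∑ k ∈ Finset.range n, h (S^[k] x) ≤ n * r + garsia S h r n x := by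
  induction n generalizing x with
  | zero => simp
  | succ n ih =>
    rw [Finset.sum_range_succ']
    have h1 := ih (S x)
    have h2 : h x + garsia S h r n (S x) ≤ garsia S h r (n + 1) x + r := le_tsub_add
    calc ∑ k ∈ Finset.range n, h (S^[k + 1] x) + h (S^[0] x)
        ≤ (n * r + garsia S h r n (S x)) + h x := by
          gcongr
          · simpa [Function.iterate_succ_apply] using h1
          · simp
      _ = n * r + (h x + garsia S h r n (S x)) := by ring
      _ ≤ n * r + (garsia S h r (n + 1) x + r) := by gcongr
      _ = _ := by push_cast; ring

lemma garsia_weak {S : X → X} (hS : MeasurePreserving S μ μ) {h : X → ℝ≥0∞} (hh : Measurable h)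
    (hfin : ∫⁻ x, h x ∂μ ≠ ∞) (r : ℝ≥0∞) (n : ℕ) :
    r * μ {x | 0 < garsia S h r n x} ≤ ∫⁻ x, h x ∂μ := by
  have hm := garsia_meas hS.measurable hh r n
  have hset : MeasurableSet {x | 0 < garsia S h r n x} := measurableSet_lt measurable_const hm
  have key : ∀ x, {x | 0 < garsia S h r n x}.indicator (fun _ => r) x + garsia S h r n x
      ≤ h x + garsia S h r n (S x) := by
    intro x
    by_cases hx : 0 < garsia S h r n x
    · rw [indicator_of_mem (by exact hx)]
      have h1 := garsia_mono S h r n x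
      have h2 : 0 < (h x + garsia S h r n (S x)) - r := hx.trans_le h1
      calc r + garsia S h r n x ≤ r + ((h x + garsia S h r n (S x)) - r) := by gcongr; exact h1
        _ = _ := add_tsub_cancel_of_le (tsub_pos_iff_lt.1 h2).le
    · rw [indicator_of_notMem (by exact hx)]
      have : garsia S h r n x = 0 := by simpa using hx
      simp [this]
  have := lintegral_mono (μ := μ) key
  rw [lintegral_add_right _ hm, lintegral_add_left hh, hS.lintegral_comp hm,
    lintegral_indicator hset, lintegral_const] at this
  simp only [Measure.restrict_apply_univ] at this
  exact (ENNReal.add_le_add_iff_right (garsia_fin hS hh hfin r n)).1 this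

lemma discrete_weak {S : X → X} (hS : MeasurePreserving S μ μ) {h : X → ℝ≥0∞} (hh : Measurable h)
    (hfin : ∫⁻ x, h x ∂μ ≠ ∞) (r : ℝ≥0∞) :
    r * μ {x | ∃ n : ℕ, n * r < ∑ k ∈ Finset.range n, h (S^[k] x)} ≤ ∫⁻ x, h x ∂μ := by
  have hsub : {x | ∃ n : ℕ, n * r < ∑ k ∈ Finset.range n, h (S^[k] x)}
      ⊆ ⋃ n, {x | 0 < garsia S h r n x} := by
    rintro x ⟨n, hn⟩
    refine mem_iUnion.2 ⟨n, ?_⟩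
    have := hn.trans_le (garsia_sum S h r n x)
    by_contra h0
    have h0' : garsia S h r n x = 0 := by simpa using h0
    simp [h0'] at this
  have hmono : Monotone fun n => {x | 0 < garsia S h r n x} :=
    monotone_nat_of_le_succ fun n x hx => lt_of_lt_of_le hx (garsia_mono S h r n x)
  calc _ ≤ r * μ (⋃ n, {x | 0 < garsia S h r n x}) := by gcongr
    _ = ⨆ n, r * μ {x | 0 < garsia S h r n x} := by
      rw [hmono.measure_iUnion, ENNReal.mul_iSup]
    _ ≤ _ := iSup_le fun n => garsia_weak hS hh hfin r n

variable {T : ℝ → X → X}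

lemma iter_eq (hT : ErgodicFlow X μ T) (e : ℝ) (k : ℕ) (x : X) : (T e)^[k] x = T (k * e) x := by
  induction k with
  | zero => simp [hT.map_zero]
  | succ k ih =>
    rw [Function.iterate_succ_apply', ih, ← hT.map_add]; congr 1; push_cast; ring

lemma sum_eq (hT : ErgodicFlow X μ T) {h : X → ℝ≥0∞} (hh : Measurable h) {e : ℝ} (he : 0 < e)
    (n : ℕ) (x : X) :
    ∑ k ∈ Finset.range n, (∫⁻ τ in Ioc 0 e, h (T τ ((T e)^[k] x)))
      = ∫⁻ τ in Ioc 0 (n * e), h (T τ x) := by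
  induction n with
  | zero => simp
  | succ n ih =>
    rw [Finset.sum_range_succ, ih, iter_eq hT]
    have hu : Ioc (0:ℝ) ((n + 1 : ℕ) * e) = Ioc 0 (n * e) ∪ Ioc (n * e) ((n + 1 : ℕ) * e) := by
      rw [Ioc_union_Ioc_eq_Ioc] <;> push_cast <;> nlinarith [mul_nonneg (Nat.cast_nonneg (α := ℝ) n) he.le]
    rw [hu, lintegral_union measurableSet_Ioc (Ioc_disjoint_Ioc_of_le le_rfl)]
    congr 1
    have hmp := (measurePreserving_add_right (volume : Measure ℝ) ((n:ℝ) * e)).setLIntegral_comp_preimage_emb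
      (measurableEmbedding_addRight _) (fun τ => h (T τ x)) (Ioc (n * e) ((n + 1 : ℕ) * e))
    rw [← hmp]
    have : (fun τ : ℝ => τ + n * e) ⁻¹' Ioc (n * e) ((n + 1 : ℕ) * e) = Ioc 0 e := by
      ext τ; simp only [mem_preimage, mem_Ioc]; push_cast
      constructor <;> rintro ⟨h1, h2⟩ <;> constructor <;> linarith
    rw [this]
    simp only [hT.map_add]

lemma avg_meas (hT : ErgodicFlow X μ T) {h : X → ℝ≥0∞} (hh : Measurable h) (e : ℝ) :
    Measurable fun x => ∫⁻ τ in Ioc 0 e, h (T τ x) := by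
  have : Measurable fun p : X × ℝ => h (T p.2 p.1) := hh.comp (hT.measurable.comp measurable_swap)
  exact this.lintegral_prod_right'

lemma avg_int [SFinite μ] (hT : ErgodicFlow X μ T) {h : X → ℝ≥0∞} (hh : Measurable h) (e : ℝ) :
    ∫⁻ x, (∫⁻ τ in Ioc 0 e, h (T τ x)) ∂μ = ENNReal.ofReal e * ∫⁻ x, h x ∂μ := by
  have hm : Measurable fun p : X × ℝ => h (T p.2 p.1) := hh.comp (hT.measurable.comp measurable_swap)
  rw [lintegral_lintegral_swap hm.aemeasurable]
  have : ∀ τ, ∫⁻ x, h (T τ x) ∂μ = ∫⁻ x, h x ∂μ := fun τ => (hT.preserving τ).lintegral_comp hh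
  simp only [this, lintegral_const, Measure.restrict_apply_univ, Real.volume_Ioc, sub_zero]
  rw [mul_comm]

lemma flow_weak_e [SFinite μ] (hT : ErgodicFlow X μ T) {h : X → ℝ≥0∞} (hh : Measurable h)
    (hfin : ∫⁻ x, h x ∂μ ≠ ∞) (r : ℝ≥0∞) {e : ℝ} (he : 0 < e) :
    r * μ {x | ∃ n : ℕ, ENNReal.ofReal (n * e) * r < ∫⁻ τ in Ioc 0 (n * e), h (T τ x)}
      ≤ ∫⁻ x, h x ∂μ := by
  have he0 : ENNReal.ofReal e ≠ 0 := by simpa using he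
  have := discrete_weak (hT.preserving e) (avg_meas hT hh e)
    (by rw [avg_int hT hh]; exact ENNReal.mul_ne_top ENNReal.ofReal_ne_top hfin)
    (ENNReal.ofReal e * r)
  rw [avg_int hT hh, mul_assoc, ENNReal.mul_le_mul_iff_right he0 ENNReal.ofReal_ne_top] at this
  simp only [sum_eq hT hh he] at this
  convert this using 8
  rw [ENNReal.ofReal_mul (by positivity), ENNReal.ofReal_natCast, mul_assoc]

lemma flow_weak [SFinite μ] (hT : ErgodicFlow X μ T) {h : X → ℝ≥0∞} (hh : Measurable h)
    (hfin : ∫⁻ x, h x ∂μ ≠ ∞) (r : ℝ≥0∞) (hr : r ≠ ∞) :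
    r * μ {x | ∃ a : ℝ, 0 < a ∧ ENNReal.ofReal a * r < ∫⁻ τ in Ioc 0 a, h (T τ x)}
      ≤ ∫⁻ x, h x ∂μ := by
  set E : ℕ → Set X := fun j =>
    {x | ∃ n : ℕ, ENNReal.ofReal (n * (1 / 2 : ℝ) ^ j) * r
      < ∫⁻ τ in Ioc 0 (n * (1 / 2 : ℝ) ^ j), h (T τ x)} with hE
  have hmono : Monotone E := by
    refine monotone_nat_of_le_succ fun j x => ?_
    rintro ⟨n, hn⟩
    refine ⟨2 * n, ?_⟩
    have : (((2 * n : ℕ) : ℝ) * (1 / 2 : ℝ) ^ (j + 1)) = n * (1 / 2 : ℝ) ^ j := by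
      push_cast; rw [pow_succ]; ring
    rwa [this]
  have hsub : {x | ∃ a : ℝ, 0 < a ∧ ENNReal.ofReal a * r < ∫⁻ τ in Ioc 0 a, h (T τ x)}
      ⊆ ⋃ j, E j := by
    rintro x ⟨a, ha, hx⟩
    have hlim : Tendsto (fun j : ℕ => ENNReal.ofReal (a + (1 / 2 : ℝ) ^ j) * r) atTop
        (𝓝 (ENNReal.ofReal a * r)) := by
      refine ENNReal.Tendsto.mul_const ?_ (Or.inr hr)
      refine ENNReal.tendsto_ofReal ?_
      simpa using (tendsto_const_nhds (x := a)).add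
        (tendsto_pow_atTop_nhds_zero_of_lt_one (r := (1 / 2 : ℝ)) (by norm_num) (by norm_num))
    obtain ⟨j, hj⟩ := (hlim.eventually_lt_const hx).exists
    refine mem_iUnion.2 ⟨j, ⌈a / (1 / 2 : ℝ) ^ j⌉₊, ?_⟩
    have hp : (0 : ℝ) < (1 / 2 : ℝ) ^ j := by positivity
    have h1 : a ≤ ⌈a / (1 / 2 : ℝ) ^ j⌉₊ * (1 / 2 : ℝ) ^ j := (div_le_iff₀ hp).1 (Nat.le_ceil _)
    have h2 : ⌈a / (1 / 2 : ℝ) ^ j⌉₊ * (1 / 2 : ℝ) ^ j ≤ a + (1 / 2 : ℝ) ^ j := by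
      have := (Nat.ceil_lt_add_one (div_pos ha hp).le).le
      calc _ ≤ (a / (1 / 2 : ℝ) ^ j + 1) * (1 / 2 : ℝ) ^ j := by gcongr
        _ = _ := by field_simp
    calc _ ≤ ENNReal.ofReal (a + (1 / 2 : ℝ) ^ j) * r := by gcongr
      _ < _ := hj
      _ ≤ _ := lintegral_mono_set (Ioc_subset_Ioc_right h1)
  calc _ ≤ r * μ (⋃ j, E j) := by gcongr
    _ = ⨆ j, r * μ (E j) := by rw [hmono.measure_iUnion, ENNReal.mul_iSup]
    _ ≤ _ := iSup_le fun j => flow_weak_e hT hh hfin r (by positivity)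

/-! Rearrangement facts -/

lemma rearr_bdd {f : X → ℝ} (hf : Integrable f μ) {v : ℝ} (hv : 0 < v) :
    BddAbove {s : ℝ | 0 ≤ s ∧ ENNReal.ofReal v < μ {x | s < |f x|}} := by
  refine ⟨(∫⁻ x, ENNReal.ofReal |f x| ∂μ).toReal / v, ?_⟩
  rintro s ⟨hs, hlt⟩
  have hI : ∫⁻ x, ENNReal.ofReal |f x| ∂μ ≠ ∞ := by
    have := hf.2
    rw [hasFiniteIntegral_iff_norm] at this
    exact this.ne
  rw [le_div_iff₀ hv]
  have h1 : ENNReal.ofReal s * ENNReal.ofReal v ≤ ∫⁻ x, ENNReal.ofReal |f x| ∂μ := by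
    calc _ ≤ ENNReal.ofReal s * μ {x | ENNReal.ofReal s ≤ ENNReal.ofReal |f x|} := by
          gcongr
          refine hlt.le.trans (measure_mono fun x hx => ?_)
          exact ENNReal.ofReal_le_ofReal (le_of_lt hx)
      _ ≤ _ := mul_meas_ge_le_lintegral₀ hf.1.norm.aemeasurable.ennreal_ofReal _
  rw [← ENNReal.ofReal_mul hs] at h1
  exact (ENNReal.ofReal_le_iff_le_toReal hI).1 h1

lemma rearr_nonneg (f : X → ℝ) (v : ℝ) : 0 ≤ rearrange μ f v :=
  Real.sSup_nonneg fun _ h => h.1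

lemma le_rearr {f : X → ℝ} (hf : Integrable f μ) {v : ℝ} (hv : 0 < v) {y : ℝ} (hy : 0 ≤ y)
    (h : ENNReal.ofReal v < μ {x | y < |f x|}) : y ≤ rearrange μ f v :=
  le_csSup (rearr_bdd hf hv) ⟨hy, h⟩

lemma lt_of_lt_rearr {f : X → ℝ} {v : ℝ} {y : ℝ} (hy : 0 ≤ y)
    (h : y < rearrange μ f v) : ENNReal.ofReal v < μ {x | y < |f x|} := by
  have hne : {s : ℝ | 0 ≤ s ∧ ENNReal.ofReal v < μ {x | s < |f x|}}.Nonempty := by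
    by_contra hne
    rw [not_nonempty_iff_eq_empty] at hne
    rw [rearrange, hne, Real.sSup_empty] at h
    linarith
  obtain ⟨s, hs, hys⟩ := exists_lt_of_lt_csSup hne h
  exact hs.2.trans_le (measure_mono fun x hx => hys.trans hx)

lemma rearr_anti {f : X → ℝ} (hf : Integrable f μ) : AntitoneOn (rearrange μ f) (Ioi 0) := by
  intro u hu v hv huv
  refine Real.sSup_le (fun s hs => ?_) (rearr_nonneg f u)
  exact le_rearr hf hu hs.1 ((ENNReal.ofReal_le_ofReal huv).trans_lt hs.2)

lemma rearr_integrable {f : X → ℝ} (hf : Integrable f μ) (t : ℝ) :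
    IntegrableOn (rearrange μ f) (Ioo 0 t) := by
  have hm : AEMeasurable (rearrange μ f) (volume.restrict (Ioo 0 t)) :=
    aemeasurable_restrict_of_antitoneOn measurableSet_Ioo
      ((rearr_anti hf).mono fun x hx => hx.1)
  refine ⟨hm.aestronglyMeasurable, ?_⟩
  rw [hasFiniteIntegral_iff_ofReal (Eventually.of_forall fun v => rearr_nonneg f v),
    lintegral_eq_lintegral_meas_lt _ (Eventually.of_forall fun v => rearr_nonneg f v) hm]
  have hI : ∫⁻ x, ENNReal.ofReal |f x| ∂μ < ∞ := by
    have := hf.2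
    rwa [hasFiniteIntegral_iff_norm] at this
  rw [lintegral_eq_lintegral_meas_lt _ (Eventually.of_forall fun v => abs_nonneg _)
    hf.1.norm.aemeasurable] at hI
  refine lt_of_le_of_lt (setLIntegral_mono' measurableSet_Ioi fun y hy => ?_) hI
  rw [Measure.restrict_apply' measurableSet_Ioo]
  have hy0 : (0:ℝ) < y := hy
  by_cases htop : μ {x | y < |f x|} = ∞
  · simp [htop]
  calc _ ≤ volume (Ioo (0:ℝ) (μ {x | y < |f x|}).toReal) := by
        refine measure_mono ?_
        rintro v ⟨hv1, hv2⟩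
        refine ⟨hv2.1, ?_⟩
        exact (ENNReal.ofReal_lt_iff_lt_toReal hv2.1.le htop).1 (lt_of_lt_rearr hy0.le hv1)
    _ = _ := by rw [Real.volume_Ioo, sub_zero, ENNReal.ofReal_toReal htop]

lemma key_le {f : X → ℝ} (hf : Integrable f μ) {t : ℝ} (ht : 0 < t) :
    ∫⁻ x, ENNReal.ofReal (|f x| - rearrange μ f t) ∂μ
      ≤ ENNReal.ofReal ((∫ v in Ioo (0:ℝ) t, rearrange μ f v) - t * rearrange μ f t) := by
  set c := rearrange μ f t with hc
  have hc0 : 0 ≤ c := rearr_nonneg f t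
  have hint := rearr_integrable hf t
  have h1 : ∫ v in Ioo (0:ℝ) t, (rearrange μ f v - c)
      = (∫ v in Ioo (0:ℝ) t, rearrange μ f v) - t * c := by
    rw [integral_sub hint (integrable_const c)]
    simp [ht.le]
  have hge : ∀ᵐ v ∂(volume.restrict (Ioo (0:ℝ) t)), 0 ≤ rearrange μ f v - c := by
    filter_upwards [ae_restrict_mem measurableSet_Ioo] with v hv
    exact sub_nonneg.2 (rearr_anti hf hv.1 ht hv.2.le)
  have hint2 : Integrable (fun v => rearrange μ f v - c) (volume.restrict (Ioo (0:ℝ) t)) :=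
    hint.sub (integrable_const c)
  rw [← h1, ofReal_integral_eq_lintegral_ofReal hint2 hge,
    lintegral_eq_lintegral_meas_le _ hge hint2.1.aemeasurable]
  have h2 : ∀ x, ENNReal.ofReal (|f x| - c) = ENNReal.ofReal (max (|f x| - c) 0) := by
    intro x; simp [ENNReal.ofReal_max]
  simp only [h2]
  rw [lintegral_eq_lintegral_meas_lt (f := fun x => max (|f x| - c) 0) _
    (Eventually.of_forall fun v => le_max_right _ _)
    ((hf.1.norm.aemeasurable.sub_const c).max aemeasurable_const)]
  refine setLIntegral_mono' measurableSet_Ioi fun y hy => ?_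
  have hy0 : (0:ℝ) < y := hy
  have hset : {a | y < max (|f a| - c) 0} = {a | c + y < |f a|} := by
    ext a
    simp only [mem_setOf_eq, lt_max_iff, hy0.le.not_gt, or_false]
    constructor <;> intro h <;> linarith
  rw [hset]
  have hle : μ {a | c + y < |f a|} ≤ ENNReal.ofReal t := by
    by_contra hcon
    have := le_rearr hf ht (by positivity) (not_le.1 hcon)
    linarith
  have hfin : μ {a | c + y < |f a|} ≠ ∞ := ne_top_of_le_ne_top ENNReal.ofReal_ne_top hle
  rw [Measure.restrict_apply' measurableSet_Ioo]
  calc _ = volume (Ioo (0:ℝ) (μ {a | c + y < |f a|}).toReal) := by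
        rw [Real.volume_Ioo, sub_zero, ENNReal.ofReal_toReal hfin]
    _ ≤ _ := by
        refine measure_mono ?_
        rintro v ⟨hv1, hv2⟩
        refine ⟨?_, hv1, hv2.trans_le (ENNReal.toReal_le_of_le_ofReal ht.le hle)⟩
        have := le_rearr hf hv1 (y := c + y) (by positivity)
          ((ENNReal.ofReal_lt_iff_lt_toReal hv1.le hfin).2 hv2)
        change y ≤ rearrange μ f v - c
        linarith

lemma ae_ae [SFinite μ] (hT : ErgodicFlow X μ T) {f g : X → ℝ} (h : f =ᵐ[μ] g) :
    ∀ᵐ x ∂μ, ∀ᵐ τ : ℝ, f (T τ x) = g (T τ x) := by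
  obtain ⟨N, hN, hNm, hN0⟩ := exists_measurable_superset_of_null (ae_iff.1 h)
  have hm : MeasurableSet {p : ℝ × X | T p.1 p.2 ∉ N} := hT.measurable hNm.compl
  have h1 : ∀ᵐ τ : ℝ, ∀ᵐ x ∂μ, T τ x ∉ N := Eventually.of_forall fun τ =>
    (hT.preserving τ).quasiMeasurePreserving.ae (measure_eq_zero_iff_ae_notMem.1 hN0)
  have h2 : ∀ᵐ x ∂μ, ∀ᵐ τ : ℝ, T τ x ∉ N := by
    have h3 := (Measure.ae_prod_iff_ae_ae (μ := (volume : Measure ℝ)) (ν := μ) hm).2 h1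
    exact (Measure.ae_ae_comm (p := fun τ x => T τ x ∉ N) hm).1 h1
  filter_upwards [h2] with x hx
  filter_upwards [hx] with τ hτ
  by_contra hne
  exact hτ (hN hne)

end S17

open S17 in
/-- estimate (4.29).  For an ergodic flow `(T_τ)` on a σ-finite
measure space `(X,μ)` and `f ∈ L¹(X,μ)`, the non-increasing rearrangement of the
ergodic maximal function satisfies `(Mf)*(t) ≤ f**(t)` for all `t > 0`. -/
theorem statement17 {X : Type*} [MeasurableSpace X] (μ : Measure X) [SigmaFinite μ]
    (T : ℝ → X → X) (hT : ErgodicFlow X μ T)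
    (f : X → ℝ) (hf : Integrable f μ) :
    ∀ t : ℝ, 0 < t → rearrange μ (ergMax T f) t ≤ doubleStar μ f t := by
  intro t ht
  set c := rearrange μ f t with hc
  have hc0 : 0 ≤ c := rearr_nonneg f t
  set J := ∫ v in Ioo (0:ℝ) t, rearrange μ f v with hJ
  have hkey := key_le hf ht
  rw [← hc, ← hJ] at hkey
  have hcJ : t * c ≤ J := by
    have : ∫ v in Ioo (0:ℝ) t, c ≤ J := by
      refine setIntegral_mono_on (integrable_const c) (rearr_integrable hf t)
        measurableSet_Ioo fun v hv => ?_
      exact rearr_anti hf hv.1 ht hv.2.le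
    simpa [ht.le] using this
  have hds : doubleStar μ f t = J / t := by rw [doubleStar]; ring
  rw [hds]
  refine Real.sSup_le (fun s hs => ?_) (div_nonneg (le_trans (by positivity) hcJ) ht.le)
  obtain ⟨hs0, hs⟩ := hs
  rw [le_div_iff₀ ht]
  by_cases hsc : s ≤ c
  · nlinarith
  push Not at hsc
  -- measurable representative
  obtain ⟨g, hgm, hfg⟩ := hf.1
  have hgm' : Measurable g := hgm.measurable
  set h : X → ℝ≥0∞ := fun x => ENNReal.ofReal (|g x| - c) with hh
  have hhm : Measurable h := by
    have : Measurable fun x => |g x| := hgm'.abs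
    exact (this.sub_const c).ennreal_ofReal
  have hhint : ∫⁻ x, h x ∂μ ≤ ENNReal.ofReal (J - t * c) := by
    refine le_trans (le_of_eq (lintegral_congr_ae ?_)) hkey
    filter_upwards [hfg] with x hx
    simp [hh, hx]
  have hweak := flow_weak hT hhm (ne_top_of_le_ne_top ENNReal.ofReal_ne_top hhint)
    (ENNReal.ofReal (s - c)) ENNReal.ofReal_ne_top
  have hle : μ {x | s < |ergMax T f x|} ≤ μ {x | ∃ a : ℝ, 0 < a ∧
      ENNReal.ofReal a * ENNReal.ofReal (s - c) < ∫⁻ τ in Ioc 0 a, h (T τ x)} := by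
    refine measure_mono_ae ?_
    filter_upwards [ae_ae hT hfg] with x hx hsx
    have hsx' : s < |ergMax T f x| := hsx
    have hnn : 0 ≤ ergMax T f x := Real.iSup_nonneg fun a =>
      mul_nonneg (by have := a.2; positivity) (integral_nonneg fun _ => abs_nonneg _)
    rw [abs_of_nonneg hnn] at hsx'
    haveI : Nonempty {a : ℝ // 0 < a} := ⟨⟨1, one_pos⟩⟩
    obtain ⟨⟨a, ha⟩, hlt⟩ := exists_lt_of_lt_ciSup hsx'
    refine ⟨a, ha, ?_⟩
    dsimp only at hlt
    have hlt2 : s * a < ∫ τ in Ioo (0:ℝ) a, |f (T τ x)| := by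
      rw [one_div, inv_mul_eq_div, lt_div_iff₀ ha] at hlt
      exact hlt
    have hpos : 0 < ∫ τ in Ioo (0:ℝ) a, |f (T τ x)| := lt_of_le_of_lt (by positivity) hlt2
    have hi : Integrable (fun τ => |f (T τ x)|) (volume.restrict (Ioo (0:ℝ) a)) := by
      by_contra hni
      rw [integral_undef hni] at hpos
      exact lt_irrefl _ hpos
    have hi2 : Integrable (fun τ => |f (T τ x)| - c) (volume.restrict (Ioo (0:ℝ) a)) :=
      hi.sub (integrable_const c)
    have hv : ∫ τ in Ioo (0:ℝ) a, (|f (T τ x)| - c)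
        = (∫ τ in Ioo (0:ℝ) a, |f (T τ x)|) - a * c := by
      rw [integral_sub hi (integrable_const c)]
      simp [ha.le]
    have hlt3 : a * (s - c) < ∫ τ in Ioo (0:ℝ) a, (|f (T τ x)| - c) := by
      rw [hv]; nlinarith
    have h4 : ENNReal.ofReal (∫ τ in Ioo (0:ℝ) a, (|f (T τ x)| - c))
        ≤ ∫⁻ τ in Ioo (0:ℝ) a, ENNReal.ofReal (|f (T τ x)| - c) := by
      rw [integral_eq_lintegral_pos_part_sub_lintegral_neg_part hi2]
      exact (ENNReal.ofReal_le_ofReal (sub_le_self _ ENNReal.toReal_nonneg)).trans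
        ENNReal.ofReal_toReal_le
    rw [← ENNReal.ofReal_mul ha.le]
    calc _ < ENNReal.ofReal (∫ τ in Ioo (0:ℝ) a, (|f (T τ x)| - c)) :=
          (ENNReal.ofReal_lt_ofReal_iff (lt_of_le_of_lt
            (mul_nonneg ha.le (sub_nonneg.2 hsc.le)) hlt3)).2 hlt3
      _ ≤ _ := h4
      _ = ∫⁻ τ in Ioo (0:ℝ) a, h (T τ x) := by
          refine lintegral_congr_ae (ae_restrict_of_ae ?_)
          filter_upwards [hx] with τ hτ
          simp [hh, hτ]
      _ ≤ _ := lintegral_mono_set Ioo_subset_Ioc_self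
  have hfinal : ENNReal.ofReal (s - c) * ENNReal.ofReal t ≤ ENNReal.ofReal (J - t * c) :=
    le_trans (by gcongr; exact hs.le.trans hle) (hweak.trans hhint)
  rw [← ENNReal.ofReal_mul (sub_nonneg.2 hsc.le),
    ENNReal.ofReal_le_ofReal_iff (sub_nonneg.2 hcJ)] at hfinal
  nlinarith

end
end
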